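/- arXiv:1707.00047 — 3 statements merged into one kernel-verified Lean document; each statement's English description precedes it below -/
import Mathlib

section
/- Let n ≥ 1, let φ be a positive definite n×n complex matrix, let k be an arbitrary n×n complex matrix, and let 1 < p ≤ 2. Then the infimum, over all n×n positive definite density matrices σ, of the Frobenius norm ‖σ^{1/2−1/p} kᴴ φ^{1/p−1/2}‖_2 equals the Schatten p-norm ‖kᴴ φ^{1/p−1/2}‖_p. (This is the finite-dimensional content of Lemma 2.3 of the paper: the Araki–Masuda L_p-norm of k with weight φ, for 1 < p ≤ 2, equals the Schatten p-norm of kᴴ φ^{1/p−1/2}.) -/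
open Matrix
open scoped ComplexOrder

/-- Real power of a matrix, defined via the spectral decomposition when the matrix is
Hermitian (applying the real power function to the eigenvalues), and `0` otherwise. -/
noncomputable def mpow {n : ℕ} (A : Matrix (Fin n) (Fin n) ℂ) (r : ℝ) :
    Matrix (Fin n) (Fin n) ℂ :=
  if hA : A.IsHermitian then
    (hA.eigenvectorUnitary : Matrix (Fin n) (Fin n) ℂ) *
      Matrix.diagonal (fun i => ((hA.eigenvalues i ^ r : ℝ) : ℂ)) *
      (star hA.eigenvectorUnitary : Matrix (Fin n) (Fin n) ℂ)
  else 0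

/-- The Schatten `p`-norm of a complex matrix:
`‖X‖_p = (Tr[(Xᴴ X)^(p/2)])^(1/p)`. For `p = 2` this is the Frobenius norm. -/
noncomputable def schattenNorm {n : ℕ} (p : ℝ) (X : Matrix (Fin n) (Fin n) ℂ) : ℝ :=
  ((Matrix.trace (mpow (Xᴴ * X) (p / 2))).re) ^ (1 / p)


lemma trace_mpow_re {n : ℕ} {A : Matrix (Fin n) (Fin n) ℂ} (hA : A.IsHermitian) (r : ℝ) :
    (mpow A r).trace.re = ∑ i, hA.eigenvalues i ^ r := by
  rw [mpow, dif_pos hA, Matrix.trace_mul_comm, ← Matrix.mul_assoc]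
  simp [Matrix.trace_diagonal, ← Complex.ofReal_sum]

lemma eq_eigenvectorUnitary_mul_diagonal_mul {n : ℕ} {A : Matrix (Fin n) (Fin n) ℂ}
    (hA : A.IsHermitian) :
    A = (hA.eigenvectorUnitary : Matrix (Fin n) (Fin n) ℂ) *
      Matrix.diagonal (fun i => ((hA.eigenvalues i : ℝ) : ℂ)) *
      (hA.eigenvectorUnitary : Matrix (Fin n) (Fin n) ℂ)ᴴ := by
  conv_lhs => rw [hA.spectral_theorem]
  rfl

lemma mpow_one {n : ℕ} {A : Matrix (Fin n) (Fin n) ℂ} (hA : A.IsHermitian) : mpow A 1 = A := by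
  conv_rhs => rw [eq_eigenvectorUnitary_mul_diagonal_mul hA]
  simp [mpow, dif_pos hA, Matrix.star_eq_conjTranspose]

lemma conj_diagonal_rpow_eq {n : ℕ} {U V : Matrix (Fin n) (Fin n) ℂ}
    (hU : U ∈ unitaryGroup (Fin n) ℂ) (hV : V ∈ unitaryGroup (Fin n) ℂ) {d e : Fin n → ℝ}
    (h : U * diagonal (fun i => (d i : ℂ)) * Uᴴ = V * diagonal (fun i => (e i : ℂ)) * Vᴴ)
    (r : ℝ) :
    U * diagonal (fun i => ((d i ^ r : ℝ) : ℂ)) * Uᴴ =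
      V * diagonal (fun i => ((e i ^ r : ℝ) : ℂ)) * Vᴴ := by
  have hU1 : Uᴴ * U = 1 := mem_unitaryGroup_iff'.1 hU
  have hU2 : U * Uᴴ = 1 := mem_unitaryGroup_iff.1 hU
  have hV1 : Vᴴ * V = 1 := mem_unitaryGroup_iff'.1 hV
  have hV2 : V * Vᴴ = 1 := mem_unitaryGroup_iff.1 hV
  have hW : (Vᴴ * U) * diagonal (fun i => (d i : ℂ)) =
      diagonal (fun i => (e i : ℂ)) * (Vᴴ * U) := by
    calc _ = Vᴴ * (U * diagonal (fun i => (d i : ℂ)) * Uᴴ) * U := by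
          simp only [Matrix.mul_assoc, hU1, Matrix.mul_one]
      _ = _ := by
          rw [h]
          simp only [← Matrix.mul_assoc, hV1, Matrix.one_mul]
  have hWr : (Vᴴ * U) * diagonal (fun i => ((d i ^ r : ℝ) : ℂ)) =
      diagonal (fun i => ((e i ^ r : ℝ) : ℂ)) * (Vᴴ * U) := by
    ext i j
    have hij := congrFun (congrFun hW i) j
    rw [mul_diagonal, diagonal_mul] at hij ⊢
    by_cases h0 : (Vᴴ * U) i j = 0
    · simp [h0]
    · have : (d j : ℂ) = e i := by
        rw [mul_comm] at hij
        exact mul_right_cancel₀ h0 hij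
      rw [Complex.ofReal_inj.1 this, mul_comm]
  calc _ = V * ((Vᴴ * U) * diagonal (fun i => ((d i ^ r : ℝ) : ℂ))) * Uᴴ := by
        simp only [← Matrix.mul_assoc, hV2, Matrix.one_mul]
    _ = _ := by
        rw [hWr]
        simp only [Matrix.mul_assoc, hU2, Matrix.mul_one]

lemma mpow_conj_diagonal {n : ℕ} {U : Matrix (Fin n) (Fin n) ℂ}
    (hU : U ∈ unitaryGroup (Fin n) ℂ) (d : Fin n → ℝ) (r : ℝ) :
    mpow (U * diagonal (fun i => (d i : ℂ)) * Uᴴ) r =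
      U * diagonal (fun i => ((d i ^ r : ℝ) : ℂ)) * Uᴴ := by
  have hA : (U * diagonal (fun i => (d i : ℂ)) * Uᴴ).IsHermitian :=
    isHermitian_mul_mul_conjTranspose _ (by
      rw [Matrix.IsHermitian, diagonal_conjTranspose]
      congr 1
      ext i
      simp)
  rw [mpow, dif_pos hA]
  exact conj_diagonal_rpow_eq hA.eigenvectorUnitary.2 hU
    (eq_eigenvectorUnitary_mul_diagonal_mul hA).symm r

lemma trace_mpow_conjTranspose_mul_self {n : ℕ} (B : Matrix (Fin n) (Fin n) ℂ) (r : ℝ) :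
    (mpow (Bᴴ * B) r).trace.re =
      ∑ i, (isHermitian_mul_conjTranspose_self B).eigenvalues i ^ r := by
  rw [trace_mpow_re (isHermitian_conjTranspose_mul_self B)]
  have h1 := (isHermitian_mul_conjTranspose_self B).roots_charpoly_eq_eigenvalues
  have h2 := (isHermitian_conjTranspose_mul_self B).roots_charpoly_eq_eigenvalues
  rw [charpoly_mul_comm, h2] at h1
  have := congrArg (fun s : Multiset ℂ => (s.map (fun z => z.re ^ r)).sum) h1
  simp only [Multiset.map_map, Function.comp_def] at this
  exact this

/-- The Frobenius norm of `V diag(c) Vᴴ B` in terms of a diagonalization of `B Bᴴ`. -/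
lemma schattenNorm_two_conj_diagonal_mul {n : ℕ} {U V B : Matrix (Fin n) (Fin n) ℂ}
    (hV : V ∈ unitaryGroup (Fin n) ℂ) {d : Fin n → ℝ}
    (hB : B * Bᴴ = U * diagonal (fun i => (d i : ℂ)) * Uᴴ) (c : Fin n → ℝ) :
    schattenNorm 2 (V * diagonal (fun i => (c i : ℂ)) * Vᴴ * B) =
      (∑ i, c i ^ 2 * ∑ j, Complex.normSq ((Vᴴ * U) i j) * d j) ^ (1 / 2 : ℝ) := by
  have hV1 : Vᴴ * V = 1 := mem_unitaryGroup_iff'.1 hV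
  rw [schattenNorm, div_self two_ne_zero, mpow_one (isHermitian_conjTranspose_mul_self _)]
  congr 1
  have hD : (diagonal (fun i => (c i : ℂ)))ᴴ = diagonal (fun i => (c i : ℂ)) := by
    rw [diagonal_conjTranspose]
    congr 1
    ext i
    simp
  have key : ((V * diagonal (fun i => (c i : ℂ)) * Vᴴ * B)ᴴ *
      (V * diagonal (fun i => (c i : ℂ)) * Vᴴ * B)).trace =
      (diagonal (fun i => (c i : ℂ)) * (diagonal (fun i => (c i : ℂ)) *
        ((Vᴴ * U) * diagonal (fun i => (d i : ℂ)) * (Vᴴ * U)ᴴ))).trace := by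
    have h1 : (Vᴴ * U) * diagonal (fun i => (d i : ℂ)) * (Vᴴ * U)ᴴ = Vᴴ * (B * Bᴴ) * V := by
      rw [hB]
      simp [Matrix.mul_assoc]
    have h2 : (V * diagonal (fun i => (c i : ℂ)) * Vᴴ * B)ᴴ *
      (V * diagonal (fun i => (c i : ℂ)) * Vᴴ * B) =
      Bᴴ * V * (diagonal (fun i => (c i : ℂ)) * (diagonal (fun i => (c i : ℂ)) * (Vᴴ * B))) := by
      simp only [conjTranspose_mul, conjTranspose_conjTranspose, hD, Matrix.mul_assoc]
      rw [← Matrix.mul_assoc Vᴴ V, hV1, Matrix.one_mul]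
    rw [h1, h2, Matrix.trace_mul_comm]
    simp only [Matrix.mul_assoc]
  rw [key, Matrix.trace, Complex.re_sum]
  refine Finset.sum_congr rfl fun i _ => ?_
  rw [diag_apply, diagonal_mul, diagonal_mul, Complex.re_ofReal_mul, Complex.re_ofReal_mul,
    ← mul_assoc, ← sq]
  congr 1
  rw [Matrix.mul_apply, Complex.re_sum]
  refine Finset.sum_congr rfl fun j _ => ?_
  rw [mul_diagonal, conjTranspose_apply, mul_right_comm, Complex.star_def, Complex.mul_conj,
    ← Complex.ofReal_mul, Complex.ofReal_re]

lemma sum_normSq_row_of_mem_unitaryGroup {n : ℕ} {W : Matrix (Fin n) (Fin n) ℂ}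
    (hW : W ∈ unitaryGroup (Fin n) ℂ) (i : Fin n) : ∑ j, Complex.normSq (W i j) = 1 := by
  have h := congrFun (congrFun (mem_unitaryGroup_iff.1 hW) i) i
  simp only [Matrix.mul_apply, star_apply, Complex.star_def, Complex.mul_conj, one_apply_eq] at h
  exact_mod_cast h

lemma sum_normSq_col_of_mem_unitaryGroup {n : ℕ} {W : Matrix (Fin n) (Fin n) ℂ}
    (hW : W ∈ unitaryGroup (Fin n) ℂ) (j : Fin n) : ∑ i, Complex.normSq (W i j) = 1 := by
  have h := congrFun (congrFun (mem_unitaryGroup_iff'.1 hW) j) j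
  simp only [Matrix.mul_apply, star_apply, Complex.star_def, ← Complex.normSq_eq_conj_mul_self,
    one_apply_eq] at h
  exact_mod_cast h

/-- Concave trace inequality: averaging by a unistochastic matrix increases `∑ xⱼ ^ r`. -/
lemma sum_rpow_le_sum_rpow_unitary {n : ℕ} {W : Matrix (Fin n) (Fin n) ℂ}
    (hW : W ∈ unitaryGroup (Fin n) ℂ) {d : Fin n → ℝ} (hd : ∀ i, 0 ≤ d i) {r : ℝ}
    (hr₀ : 0 ≤ r) (hr₁ : r ≤ 1) :
    ∑ j, d j ^ r ≤ ∑ i, (∑ j, Complex.normSq (W i j) * d j) ^ r := by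
  calc ∑ j, d j ^ r = ∑ i, ∑ j, Complex.normSq (W i j) * d j ^ r := by
        rw [Finset.sum_comm]
        simp_rw [← Finset.sum_mul, sum_normSq_col_of_mem_unitaryGroup hW, one_mul]
    _ ≤ _ := Finset.sum_le_sum fun i _ => by
        simpa using (Real.concaveOn_rpow hr₀ hr₁).le_map_sum (t := Finset.univ)
          (fun j _ => Complex.normSq_nonneg (W i j)) (sum_normSq_row_of_mem_unitaryGroup hW i)
          (fun j _ => hd j)

/-- A reverse Hölder inequality, in the normalized form `∑ s = 1`. -/
lemma sum_rpow_le_sum_rpow_mul_rpow {ι : Type*} [Fintype ι] {s m : ι → ℝ} (hs : ∀ i, 0 < s i)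
    (hs₁ : ∑ i, s i = 1) (hm : ∀ i, 0 ≤ m i) {r : ℝ} (hr₀ : 0 < r) (hr₁ : r ≤ 1) :
    ∑ i, m i ^ r ≤ (∑ i, s i ^ (1 - 1 / r) * m i) ^ r := by
  have h := (Real.concaveOn_rpow hr₀.le hr₁).le_map_sum (t := Finset.univ) (w := s)
    (p := fun i => s i ^ (-(1 / r)) * m i) (fun i _ => (hs i).le) hs₁
    (fun i _ => mul_nonneg (Real.rpow_nonneg (hs i).le _) (hm i))
  simp only [smul_eq_mul] at h
  calc ∑ i, m i ^ r = ∑ i, s i * (s i ^ (-(1 / r)) * m i) ^ r :=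
        Finset.sum_congr rfl fun i _ => by
          rw [Real.mul_rpow (Real.rpow_nonneg (hs i).le _) (hm i), ← Real.rpow_mul (hs i).le,
            neg_mul, one_div_mul_cancel hr₀.ne', Real.rpow_neg_one, ← mul_assoc,
            mul_inv_cancel₀ (hs i).ne', one_mul]
    _ ≤ (∑ i, s i * (s i ^ (-(1 / r)) * m i)) ^ r := h
    _ = _ := by
        congr 1
        refine Finset.sum_congr rfl fun i _ => ?_
        rw [← mul_assoc, sub_eq_add_neg, Real.rpow_add (hs i), Real.rpow_one]

lemma schattenNorm_le_schattenNorm_two_mpow_mul {n : ℕ} {σ B : Matrix (Fin n) (Fin n) ℂ}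
    (hσ : σ.PosDef) (hσ₁ : σ.trace = 1) {p : ℝ} (hp₀ : 0 < p) (hp₂ : p ≤ 2) :
    schattenNorm p B ≤ schattenNorm 2 (mpow σ (1 / 2 - 1 / p) * B) := by
  set hM := isHermitian_mul_conjTranspose_self B
  have hd : ∀ i, 0 ≤ hM.eigenvalues i :=
    (posSemidef_self_mul_conjTranspose B).eigenvalues_nonneg
  set V : Matrix (Fin n) (Fin n) ℂ := hσ.1.eigenvectorUnitary.1
  set U : Matrix (Fin n) (Fin n) ℂ := hM.eigenvectorUnitary.1
  have hV : V ∈ unitaryGroup (Fin n) ℂ := hσ.1.eigenvectorUnitary.2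
  have hU : U ∈ unitaryGroup (Fin n) ℂ := hM.eigenvectorUnitary.2
  have hW : Vᴴ * U ∈ unitaryGroup (Fin n) ℂ := mul_mem (Unitary.star_mem hV) hU
  have hpow : mpow σ (1 / 2 - 1 / p) = V *
      diagonal (fun i => ((hσ.1.eigenvalues i ^ (1 / 2 - 1 / p) : ℝ) : ℂ)) * Vᴴ := by
    rw [mpow, dif_pos hσ.1]
    rfl
  have hs₁ : ∑ i, hσ.1.eigenvalues i = 1 := by
    have h := hσ.1.trace_eq_sum_eigenvalues
    rw [hσ₁, ← RCLike.ofReal_sum] at h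
    exact Complex.ofReal_eq_one.1 h.symm
  rw [hpow, schattenNorm_two_conj_diagonal_mul hV (eq_eigenvectorUnitary_mul_diagonal_mul hM),
    schattenNorm, trace_mpow_conjTranspose_mul_self]
  set m : Fin n → ℝ := fun i => ∑ j, Complex.normSq ((Vᴴ * U) i j) * hM.eigenvalues j
  have hm : ∀ i, 0 ≤ m i := fun i =>
    Finset.sum_nonneg fun j _ => mul_nonneg (Complex.normSq_nonneg _) (hd j)
  have hT : ∀ i, (hσ.1.eigenvalues i ^ (1 / 2 - 1 / p)) ^ 2 =
      hσ.1.eigenvalues i ^ (1 - 1 / (p / 2)) := fun i => by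
    rw [← Real.rpow_natCast, ← Real.rpow_mul (hσ.eigenvalues_pos i).le]
    congr 1
    field_simp
    push_cast
    ring
  simp_rw [hT]
  have hle := (sum_rpow_le_sum_rpow_unitary hW hd (by positivity : 0 ≤ p / 2)
    (by linarith)).trans (sum_rpow_le_sum_rpow_mul_rpow hσ.eigenvalues_pos hs₁ hm
      (by positivity : 0 < p / 2) (by linarith))
  calc _ ≤ ((∑ i, hσ.1.eigenvalues i ^ (1 - 1 / (p / 2)) * m i) ^ (p / 2)) ^ (1 / p) :=
        Real.rpow_le_rpow (Finset.sum_nonneg fun i _ => Real.rpow_nonneg (hd i) _) hle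
          (by positivity)
    _ = _ := by
        rw [← Real.rpow_mul (Finset.sum_nonneg fun i _ =>
          mul_nonneg (Real.rpow_nonneg (hσ.eigenvalues_pos i).le _) (hm i))]
        congr 1
        field_simp

lemma exists_posDef_schattenNorm_two_mpow_mul_le {n : ℕ} (hn : 1 ≤ n)
    (B : Matrix (Fin n) (Fin n) ℂ) {p : ℝ} (hp₀ : 0 < p) (hp₂ : p ≤ 2) {ε : ℝ} (hε : 0 < ε) :
    ∃ σ : Matrix (Fin n) (Fin n) ℂ, σ.PosDef ∧ σ.trace = 1 ∧
      schattenNorm 2 (mpow σ (1 / 2 - 1 / p) * B) ≤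
        ((mpow (Bᴴ * B) (p / 2)).trace.re *
          ((mpow (Bᴴ * B) (p / 2)).trace.re + n * ε) ^ (2 / p - 1)) ^ (1 / 2 : ℝ) := by
  rw [trace_mpow_conjTranspose_mul_self]
  set hM := isHermitian_mul_conjTranspose_self B
  have hd : ∀ i, 0 ≤ hM.eigenvalues i :=
    (posSemidef_self_mul_conjTranspose B).eigenvalues_nonneg
  set d := hM.eigenvalues
  set U : Matrix (Fin n) (Fin n) ℂ := hM.eigenvectorUnitary.1
  have hU : U ∈ unitaryGroup (Fin n) ℂ := hM.eigenvectorUnitary.2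
  have hU1 : Uᴴ * U = 1 := mem_unitaryGroup_iff'.1 hU
  have hU2 : U * Uᴴ = 1 := mem_unitaryGroup_iff.1 hU
  set Z := ∑ i, d i ^ (p / 2) with hZdef
  have hZ : 0 ≤ Z := Finset.sum_nonneg fun i _ => Real.rpow_nonneg (hd i) _
  have hn' : (0 : ℝ) < n := by exact_mod_cast hn
  have hZε : 0 < Z + n * ε := by positivity
  have hnum : ∀ i, 0 < d i ^ (p / 2) + ε := fun i =>
    add_pos_of_nonneg_of_pos (Real.rpow_nonneg (hd i) _) hε
  set s : Fin n → ℝ := fun i => (d i ^ (p / 2) + ε) / (Z + n * ε)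
  have hs : ∀ i, 0 < s i := fun i => div_pos (hnum i) hZε
  have hs₁ : ∑ i, s i = 1 := by
    rw [← Finset.sum_div, Finset.sum_add_distrib, ← hZdef]
    simp only [Finset.sum_const, Finset.card_univ, Fintype.card_fin, nsmul_eq_mul]
    exact div_self hZε.ne'
  refine ⟨U * diagonal (fun i => (s i : ℂ)) * Uᴴ, ?_, ?_, ?_⟩
  · refine (PosDef.diagonal fun i => ?_).mul_mul_conjTranspose_same ?_
    · exact_mod_cast hs i
    · exact Matrix.vecMul_injective_of_isUnit (IsUnit.of_mul_eq_one _ hU2)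
  · rw [Matrix.trace_mul_comm, ← Matrix.mul_assoc, hU1, Matrix.one_mul, Matrix.trace_diagonal]
    exact_mod_cast hs₁
  · rw [mpow_conj_diagonal hU, schattenNorm_two_conj_diagonal_mul hU
      (eq_eigenvectorUnitary_mul_diagonal_mul hM)]
    change (∑ i, (s i ^ (1 / 2 - 1 / p)) ^ 2 *
      ∑ j, Complex.normSq ((Uᴴ * U) i j) * d j) ^ (1 / 2 : ℝ) ≤ _
    have hdiag : ∀ i, ∑ j, Complex.normSq ((Uᴴ * U) i j) * d j = d i := fun i => by
      simp [hU1, Matrix.one_apply, apply_ite]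
    simp_rw [hdiag]
    refine Real.rpow_le_rpow (Finset.sum_nonneg fun i _ => mul_nonneg (sq_nonneg _) (hd i)) ?_
      (by norm_num)
    rw [hZdef, Finset.sum_mul]
    refine Finset.sum_le_sum fun i _ => ?_
    rw [← hZdef]
    rcases (hd i).eq_or_lt with h0 | h0
    · rw [← h0, Real.zero_rpow (by positivity)]
      simp
    · have hexp : 0 ≤ 2 / p - 1 := by
        rw [sub_nonneg, le_div_iff₀ hp₀]
        linarith
      have hsq : (s i ^ (1 / 2 - 1 / p)) ^ 2 =
          (Z + n * ε) ^ (2 / p - 1) * (d i ^ (p / 2) + ε) ^ (-(2 / p - 1)) := by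
        rw [← Real.rpow_natCast, ← Real.rpow_mul (hs i).le,
          show (1 / 2 - 1 / p) * ((2 : ℕ) : ℝ) = -(2 / p - 1) by push_cast; ring,
          Real.div_rpow (hnum i).le hZε.le, Real.rpow_neg hZε.le, div_inv_eq_mul, mul_comm]
      have hmono : (d i ^ (p / 2) + ε) ^ (-(2 / p - 1)) ≤ (d i ^ (p / 2)) ^ (-(2 / p - 1)) :=
        Real.rpow_le_rpow_of_nonpos (Real.rpow_pos_of_pos h0 _) (by linarith) (by linarith)
      have hpow : (d i ^ (p / 2)) ^ (-(2 / p - 1)) * d i = d i ^ (p / 2) := by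
        rw [← Real.rpow_mul h0.le]
        nth_rewrite 2 [← Real.rpow_one (d i)]
        rw [← Real.rpow_add h0]
        congr 1
        field_simp
        ring
      calc _ = (Z + n * ε) ^ (2 / p - 1) * ((d i ^ (p / 2) + ε) ^ (-(2 / p - 1)) * d i) := by
            rw [hsq, mul_assoc]
        _ ≤ (Z + n * ε) ^ (2 / p - 1) * ((d i ^ (p / 2)) ^ (-(2 / p - 1)) * d i) := by
            gcongr
        _ = _ := by rw [hpow, mul_comm]

theorem araki_masuda_norm_eq_schatten {n : ℕ} (hn : 1 ≤ n)
    (φ k : Matrix (Fin n) (Fin n) ℂ) (hφ : φ.PosDef)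
    (p : ℝ) (hp₁ : 1 < p) (hp₂ : p ≤ 2) :
    sInf {x : ℝ | ∃ σ : Matrix (Fin n) (Fin n) ℂ, σ.PosDef ∧ σ.trace = 1 ∧
        x = schattenNorm 2 (mpow σ (1 / 2 - 1 / p) * kᴴ * mpow φ (1 / p - 1 / 2))} =
      schattenNorm p (kᴴ * mpow φ (1 / p - 1 / 2)) := by
  have hp₀ : 0 < p := by linarith
  simp_rw [Matrix.mul_assoc]
  set B := kᴴ * mpow φ (1 / p - 1 / 2)
  set S := {x : ℝ | ∃ σ : Matrix (Fin n) (Fin n) ℂ, σ.PosDef ∧ σ.trace = 1 ∧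
    x = schattenNorm 2 (mpow σ (1 / 2 - 1 / p) * B)}
  have hlower : ∀ x ∈ S, schattenNorm p B ≤ x := by
    rintro x ⟨σ, hσ, hσ₁, rfl⟩
    exact schattenNorm_le_schattenNorm_two_mpow_mul hσ hσ₁ hp₀ hp₂
  have hne : S.Nonempty := by
    obtain ⟨σ, hσ, hσ₁, -⟩ := exists_posDef_schattenNorm_two_mpow_mul_le hn B hp₀ hp₂ one_pos
    exact ⟨_, σ, hσ, hσ₁, rfl⟩
  refine le_antisymm ?_ (le_csInf hne hlower)
  set Z := (mpow (Bᴴ * B) (p / 2)).trace.re with hZdef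
  have hZ : 0 ≤ Z := by
    rw [hZdef, trace_mpow_conjTranspose_mul_self]
    exact Finset.sum_nonneg fun i _ => Real.rpow_nonneg
      ((posSemidef_self_mul_conjTranspose B).eigenvalues_nonneg i) _
  have hexp : 0 ≤ 2 / p - 1 := by
    rw [sub_nonneg, le_div_iff₀ hp₀]
    linarith
  have hlim : Filter.Tendsto (fun ε : ℝ => (Z * (Z + n * ε) ^ (2 / p - 1)) ^ (1 / 2 : ℝ))
      (nhdsWithin 0 (Set.Ioi 0)) (nhds (schattenNorm p B)) := by
    have hcont : Continuous fun ε : ℝ => (Z * (Z + n * ε) ^ (2 / p - 1)) ^ (1 / 2 : ℝ) :=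
      (continuous_const.mul ((by fun_prop : Continuous fun ε : ℝ => Z + n * ε).rpow_const
        fun _ => Or.inr hexp)).rpow_const fun _ => Or.inr (by norm_num)
    convert hcont.continuousWithinAt.tendsto (x := (0 : ℝ)) using 2
    rw [mul_zero, add_zero, schattenNorm, ← hZdef]
    rcases hZ.eq_or_lt with h0 | h0
    · rw [← h0, zero_mul, Real.zero_rpow (by positivity), Real.zero_rpow (by norm_num)]
    · nth_rewrite 2 [← Real.rpow_one Z]
      rw [← Real.rpow_add h0, ← Real.rpow_mul h0.le]
      congr 1
      ring
  refine ge_of_tendsto hlim (Filter.eventually_of_mem self_mem_nhdsWithin fun ε hε => ?_)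
  obtain ⟨σ, hσ, hσ₁, hle⟩ := exists_posDef_schattenNorm_two_mpow_mul_le hn B hp₀ hp₂ hε
  exact (csInf_le ⟨_, hlower⟩ ⟨σ, hσ, hσ₁, rfl⟩).trans hle
end

section
/- Let Φ : M_n(ℂ) → M_m(ℂ) be a quantum channel, let ψ be an n×n density matrix, let φ be a positive definite n×n complex matrix such that Φ(φ) is positive definite, and let α ∈ (1/2, 1). Then D_α(ψ‖φ) = D_α(Φ(ψ)‖Φ(φ)) if and only if the channel Φ is sufficient (reversible) for the pair {ψ, φ}, i.e. there exists a quantum channel Ψ : M_m(ℂ) → M_n(ℂ) such that Ψ(Φ(ψ)) = ψ and Ψ(Φ(φ)) = φ. (Finite-dimensional form of the main theorem of Section 3.) -/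
open Matrix
open scoped ComplexOrder

/-- Blockwise application of a linear map on `n × n` matrices to a `k × k` block matrix
with `n × n` blocks. -/
def blockApply {n m : ℕ} (Φ : Matrix (Fin n) (Fin n) ℂ →ₗ[ℂ] Matrix (Fin m) (Fin m) ℂ)
    (k : ℕ) (M : Matrix (Fin n × Fin k) (Fin n × Fin k) ℂ) :
    Matrix (Fin m × Fin k) (Fin m × Fin k) ℂ :=
  Matrix.of fun p q => Φ (Matrix.of fun i j => M (i, p.2) (j, q.2)) p.1 q.1

/-- A linear map is completely positive if all its blockwise applications preserve
positive semidefiniteness. -/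
def IsCompletelyPositive {n m : ℕ}
    (Φ : Matrix (Fin n) (Fin n) ℂ →ₗ[ℂ] Matrix (Fin m) (Fin m) ℂ) : Prop :=
  ∀ k : ℕ, 1 ≤ k → ∀ M : Matrix (Fin n × Fin k) (Fin n × Fin k) ℂ,
    M.PosSemidef → (blockApply Φ k M).PosSemidef

/-- A quantum channel is a completely positive trace-preserving linear map. -/
def IsQuantumChannel {n m : ℕ}
    (Φ : Matrix (Fin n) (Fin n) ℂ →ₗ[ℂ] Matrix (Fin m) (Fin m) ℂ) : Prop :=
  IsCompletelyPositive Φ ∧ ∀ X : Matrix (Fin n) (Fin n) ℂ, (Φ X).trace = X.trace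

/-- The sandwiched Rényi relative entropy
`D_α(ψ‖φ) = (1/(α−1)) · log Tr[(φ^((1−α)/(2α)) ψ φ^((1−α)/(2α)))^α]`. -/
noncomputable def sandwichedRenyi {n : ℕ} (α : ℝ)
    (ψ φ : Matrix (Fin n) (Fin n) ℂ) : ℝ :=
  (1 / (α - 1)) * Real.log
    ((Matrix.trace (mpow (mpow φ ((1 - α) / (2 * α)) * ψ * mpow φ ((1 - α) / (2 * α))) α)).re)

namespace SandwichedRenyi

open scoped Matrix.Norms.L2Operator

section FunctionalCalculus

variable {n : ℕ} {A : Matrix (Fin n) (Fin n) ℂ}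

/-- The matrix obtained by applying `g` to the eigenvalues of a Hermitian matrix. -/
noncomputable def spec (hA : A.IsHermitian) (g : ℝ → ℂ) : Matrix (Fin n) (Fin n) ℂ :=
  (hA.eigenvectorUnitary : Matrix (Fin n) (Fin n) ℂ) *
    Matrix.diagonal (fun i => g (hA.eigenvalues i)) *
    (star hA.eigenvectorUnitary : Matrix (Fin n) (Fin n) ℂ)

lemma star_eigenvectorUnitary_mul (hA : A.IsHermitian) :
    (star hA.eigenvectorUnitary : Matrix (Fin n) (Fin n) ℂ) * hA.eigenvectorUnitary = 1 :=
  Unitary.coe_star_mul_self _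

lemma eigenvectorUnitary_mul_star (hA : A.IsHermitian) :
    (hA.eigenvectorUnitary : Matrix (Fin n) (Fin n) ℂ) *
      (star hA.eigenvectorUnitary : Matrix (Fin n) (Fin n) ℂ) = 1 :=
  Unitary.coe_mul_star_self _

lemma spec_congr (hA : A.IsHermitian) {g h : ℝ → ℂ}
    (H : ∀ i, g (hA.eigenvalues i) = h (hA.eigenvalues i)) : spec hA g = spec hA h := by
  simp [spec, H]

lemma spec_mul (hA : A.IsHermitian) (g h : ℝ → ℂ) :
    spec hA g * spec hA h = spec hA (fun x => g x * h x) := by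
  simp only [spec]
  rw [← Matrix.diagonal_mul_diagonal]
  simp only [mul_assoc]
  rw [← mul_assoc (star _ : Matrix (Fin n) (Fin n) ℂ) (hA.eigenvectorUnitary : Matrix _ _ ℂ),
    star_eigenvectorUnitary_mul, one_mul]

lemma spec_add_smul (hA : A.IsHermitian) (g h : ℝ → ℂ) (c : ℂ) :
    spec hA (fun x => g x + c * h x) = spec hA g + c • spec hA h := by
  have : (Matrix.diagonal fun i => g (hA.eigenvalues i) + c * h (hA.eigenvalues i)) =
      Matrix.diagonal (fun i => g (hA.eigenvalues i)) +
        c • Matrix.diagonal (fun i => h (hA.eigenvalues i)) := by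
    rw [← Matrix.diagonal_smul, Matrix.diagonal_add]
    rfl
  simp only [spec, this, mul_add, add_mul, Matrix.mul_smul, Matrix.smul_mul]

lemma spec_one (hA : A.IsHermitian) : spec hA (fun _ => 1) = 1 := by
  simp [spec]

lemma spec_id (hA : A.IsHermitian) : spec hA (fun x => (x : ℂ)) = A := by
  conv_rhs => rw [hA.spectral_theorem]
  rw [Unitary.conjStarAlgAut_apply]
  rfl

lemma spec_conjTranspose (hA : A.IsHermitian) (g : ℝ → ℂ) :
    (spec hA g)ᴴ = spec hA (fun x => star (g x)) := by
  rw [spec, ← Matrix.star_eq_conjTranspose, star_mul, star_mul, star_star,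
    Matrix.star_eq_conjTranspose (Matrix.diagonal _), Matrix.diagonal_conjTranspose, ← mul_assoc]
  rfl

lemma trace_spec (hA : A.IsHermitian) (g : ℝ → ℂ) :
    (spec hA g).trace = ∑ i, g (hA.eigenvalues i) := by
  rw [spec, Matrix.trace_mul_cycle, star_eigenvectorUnitary_mul, one_mul, Matrix.trace_diagonal]

lemma norm_eigenvectorUnitary_le (hA : A.IsHermitian) :
    ‖(hA.eigenvectorUnitary : Matrix (Fin n) (Fin n) ℂ)‖ ≤ 1 := by
  rcases subsingleton_or_nontrivial (Matrix (Fin n) (Fin n) ℂ) with h | h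
  · simp [Subsingleton.elim (hA.eigenvectorUnitary : Matrix (Fin n) (Fin n) ℂ) 0]
  · exact (CStarRing.norm_coe_unitary _).le

lemma norm_star_eigenvectorUnitary_le (hA : A.IsHermitian) :
    ‖(star hA.eigenvectorUnitary : Matrix (Fin n) (Fin n) ℂ)‖ ≤ 1 := by
  rw [norm_star]
  exact norm_eigenvectorUnitary_le hA

lemma norm_spec_le (hA : A.IsHermitian) {g : ℝ → ℂ} {c : ℝ} (hc : 0 ≤ c)
    (h : ∀ i, ‖g (hA.eigenvalues i)‖ ≤ c) : ‖spec hA g‖ ≤ c := by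
  have h1 : ‖Matrix.diagonal (fun i => g (hA.eigenvalues i))‖ ≤ c := by
    rw [Matrix.l2_opNorm_diagonal]
    exact (pi_norm_le_iff_of_nonneg hc).2 h
  calc ‖spec hA g‖ ≤ 1 * c * 1 := by
        refine (norm_mul_le _ _).trans (mul_le_mul ((norm_mul_le _ _).trans
          (mul_le_mul (norm_eigenvectorUnitary_le hA) h1 (norm_nonneg _) zero_le_one))
          (norm_star_eigenvectorUnitary_le hA) (norm_nonneg _) (by positivity))
    _ = c := by ring

lemma sum_norm_sq_col_le {C : Matrix (Fin n) (Fin n) ℂ} (hC : ‖C‖ ≤ 1) (i : Fin n) :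
    ∑ j, ‖C j i‖ ^ 2 ≤ 1 := by
  have h := C.l2_opNorm_mulVec (EuclideanSpace.single i (1 : ℂ))
  rw [EuclideanSpace.norm_eq] at h
  simp at h
  have h2 := h.trans hC
  simpa using (Real.sqrt_le_iff.1 h2).2

lemma norm_diag_le {C : Matrix (Fin n) (Fin n) ℂ} (hC : ‖C‖ ≤ 1) (i : Fin n) :
    ‖C i i‖ ≤ 1 := by
  have h1 := sum_norm_sq_col_le hC i
  have h2 : ‖C i i‖ ^ 2 ≤ ∑ j, ‖C j i‖ ^ 2 :=
    Finset.single_le_sum (f := fun j => ‖C j i‖ ^ 2) (fun _ _ => by positivity)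
      (Finset.mem_univ i)
  nlinarith [norm_nonneg (C i i)]

lemma col_eq_of_diag_re {C : Matrix (Fin n) (Fin n) ℂ} (hC : ‖C‖ ≤ 1) {i : Fin n}
    (h : (C i i).re = 1) (j : Fin n) : C j i = (1 : Matrix (Fin n) (Fin n) ℂ) j i := by
  have h1 := sum_norm_sq_col_le hC i
  have hd : C i i = 1 := by
    have h2 := norm_diag_le hC i
    have h3 : ‖C i i‖ ^ 2 = (C i i).re ^ 2 + (C i i).im ^ 2 := by
      rw [Complex.sq_norm, Complex.normSq_apply]; ring
    have h4 : ‖C i i‖ ^ 2 ≤ 1 := by nlinarith [norm_nonneg (C i i)]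
    apply Complex.ext
    · simpa using h
    · simp only [Complex.one_im]
      nlinarith [sq_nonneg (C i i).im]
  by_cases hij : j = i
  · subst hij; simpa using hd
  · rw [Matrix.one_apply_ne hij]
    rw [← Finset.add_sum_erase _ _ (Finset.mem_univ i), hd] at h1
    have h2 : ‖C j i‖ ^ 2 ≤ ∑ k ∈ Finset.univ.erase i, ‖C k i‖ ^ 2 :=
      Finset.single_le_sum (f := fun k => ‖C k i‖ ^ 2) (fun _ _ => by positivity)
        (Finset.mem_erase.2 ⟨hij, Finset.mem_univ j⟩)
    simp only [norm_one, one_pow] at h1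
    have h3 : ‖C j i‖ ^ 2 ≤ 0 := by linarith
    simpa using h3

/-- The compression of `C` to the eigenbasis of `A`. -/
noncomputable def inEigenbasis (hA : A.IsHermitian) (C : Matrix (Fin n) (Fin n) ℂ) :
    Matrix (Fin n) (Fin n) ℂ :=
  (star hA.eigenvectorUnitary : Matrix (Fin n) (Fin n) ℂ) * C * hA.eigenvectorUnitary

lemma norm_inEigenbasis_le (hA : A.IsHermitian) {C : Matrix (Fin n) (Fin n) ℂ} (hC : ‖C‖ ≤ 1) :
    ‖inEigenbasis hA C‖ ≤ 1 := by
  have : ‖inEigenbasis hA C‖ ≤ 1 * 1 * 1 :=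
    (norm_mul_le _ _).trans (mul_le_mul ((norm_mul_le _ _).trans
      (mul_le_mul (norm_star_eigenvectorUnitary_le hA) hC (norm_nonneg _) zero_le_one))
      (norm_eigenvectorUnitary_le hA) (norm_nonneg _) (by positivity))
  simpa using this

lemma trace_spec_mul (hA : A.IsHermitian) (g : ℝ → ℂ) (C : Matrix (Fin n) (Fin n) ℂ) :
    (spec hA g * C).trace = ∑ i, g (hA.eigenvalues i) * inEigenbasis hA C i i := by
  have : (spec hA g * C).trace =
      (Matrix.diagonal (fun i => g (hA.eigenvalues i)) * inEigenbasis hA C).trace := by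
    rw [spec, inEigenbasis, mul_assoc, mul_assoc, Matrix.trace_mul_comm]
    simp only [mul_assoc]
  rw [this]
  simp [Matrix.trace, Matrix.diagonal_mul]

lemma norm_trace_spec_mul_le (hA : A.IsHermitian) {p : ℝ → ℝ}
    (hp : ∀ i, 0 ≤ p (hA.eigenvalues i)) {C : Matrix (Fin n) (Fin n) ℂ} (hC : ‖C‖ ≤ 1) :
    ‖(spec hA (fun x => (p x : ℂ)) * C).trace‖ ≤ ∑ i, p (hA.eigenvalues i) := by
  rw [trace_spec_mul]
  refine (norm_sum_le _ _).trans (Finset.sum_le_sum fun i _ => ?_)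
  rw [norm_mul, Complex.norm_real, Real.norm_of_nonneg (hp i)]
  exact mul_le_of_le_one_right (hp i) (norm_diag_le (norm_inEigenbasis_le hA hC) i)

/-- Equality in `norm_trace_spec_mul_le` forces `C` to act as the identity on the support. -/
lemma mul_spec_eq_of_trace_eq (hA : A.IsHermitian) {p : ℝ → ℝ}
    (hp : ∀ i, 0 ≤ p (hA.eigenvalues i)) {C : Matrix (Fin n) (Fin n) ℂ} (hC : ‖C‖ ≤ 1)
    (h : (spec hA (fun x => (p x : ℂ)) * C).trace = ((∑ i, p (hA.eigenvalues i) : ℝ) : ℂ))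
    {g : ℝ → ℂ} (hg : ∀ i, p (hA.eigenvalues i) = 0 → g (hA.eigenvalues i) = 0) :
    C * spec hA g = spec hA g := by
  have hC' := norm_inEigenbasis_le hA hC
  rw [trace_spec_mul] at h
  have hre := congrArg Complex.re h
  simp only [Complex.re_sum, Complex.ofReal_re, Complex.re_ofReal_mul] at hre
  have hle : ∀ i ∈ Finset.univ, p (hA.eigenvalues i) * (inEigenbasis hA C i i).re ≤
      p (hA.eigenvalues i) := fun i _ =>
    mul_le_of_le_one_right (hp i) ((Complex.re_le_norm _).trans (norm_diag_le hC' i))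
  have heq := (Finset.sum_eq_sum_iff_of_le hle).1 hre
  have hcol : inEigenbasis hA C * Matrix.diagonal (fun i => g (hA.eigenvalues i)) =
      Matrix.diagonal (fun i => g (hA.eigenvalues i)) := by
    ext j i
    rw [Matrix.mul_diagonal]
    by_cases hi : p (hA.eigenvalues i) = 0
    · rw [hg i hi, mul_zero, Matrix.diagonal_apply]
      split_ifs with hji
      · subst hji; exact (hg _ hi).symm
      · rfl
    · have h1 : (inEigenbasis hA C i i).re = 1 := by
        have := heq i (Finset.mem_univ i)
        exact mul_left_cancel₀ hi (by rw [this, mul_one])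
      rw [col_eq_of_diag_re hC' h1 j, Matrix.one_apply, Matrix.diagonal_apply]
      split_ifs with hji
      · subst hji; rw [one_mul]
      · rw [zero_mul]
  have hU : C * (hA.eigenvectorUnitary : Matrix (Fin n) (Fin n) ℂ) =
      hA.eigenvectorUnitary * inEigenbasis hA C := by
    rw [inEigenbasis, ← mul_assoc, ← mul_assoc, eigenvectorUnitary_mul_star, one_mul]
  rw [spec, ← mul_assoc, ← mul_assoc, hU, mul_assoc _ (inEigenbasis hA C), hcol]

end FunctionalCalculus

section ComplexPowers

variable {n : ℕ} {A : Matrix (Fin n) (Fin n) ℂ}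

/-- The entire function `z ↦ x ^ z`, set to `0` for `x = 0`. -/
noncomputable def suppPow (z : ℂ) (x : ℝ) : ℂ :=
  if x = 0 then 0 else Complex.exp (z * Real.log x)

lemma suppPow_mul (z w : ℂ) (x : ℝ) : suppPow z x * suppPow w x = suppPow (z + w) x := by
  unfold suppPow
  split_ifs
  · simp
  · rw [← Complex.exp_add, add_mul]

lemma star_suppPow (z : ℂ) (x : ℝ) : star (suppPow z x) = suppPow (star z) x := by
  unfold suppPow
  split_ifs
  · simp
  · rw [Complex.star_def, ← Complex.exp_conj, map_mul, Complex.conj_ofReal]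

lemma suppPow_ofReal {r x : ℝ} (hr : r ≠ 0) (hx : 0 ≤ x) :
    suppPow (r : ℂ) x = ((x ^ r : ℝ) : ℂ) := by
  unfold suppPow
  split_ifs with h
  · simp [h, Real.zero_rpow hr]
  · rw [Real.rpow_def_of_pos (lt_of_le_of_ne hx (Ne.symm h)), mul_comm]
    push_cast
    rfl

lemma norm_suppPow_le {z : ℂ} {x : ℝ} (hz : z.re = 0) : ‖suppPow z x‖ ≤ 1 := by
  unfold suppPow
  split_ifs
  · simp
  · simp [Complex.norm_exp, hz]

/-- Complex powers of a positive semidefinite matrix, supported on the range of the matrix. -/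
noncomputable def cpow (hA : A.PosSemidef) (z : ℂ) : Matrix (Fin n) (Fin n) ℂ :=
  spec hA.1 (suppPow z)

lemma cpow_mul (hA : A.PosSemidef) (z w : ℂ) : cpow hA z * cpow hA w = cpow hA (z + w) := by
  rw [cpow, cpow, spec_mul]
  simp only [suppPow_mul]
  rfl

lemma cpow_conjTranspose (hA : A.PosSemidef) (z : ℂ) : (cpow hA z)ᴴ = cpow hA (star z) := by
  rw [cpow, spec_conjTranspose]
  simp only [star_suppPow]
  rfl

lemma cpow_eq_mpow (hA : A.PosSemidef) {r : ℝ} (hr : r ≠ 0) : cpow hA r = mpow A r := by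
  rw [mpow, dif_pos hA.1]
  exact spec_congr hA.1 (h := fun x => ((x ^ r : ℝ) : ℂ))
    fun i => suppPow_ofReal hr (hA.eigenvalues_nonneg i)

lemma cpow_one (hA : A.PosSemidef) : cpow hA 1 = A := by
  conv_rhs => rw [← spec_id hA.1]
  refine spec_congr hA.1 fun i => ?_
  have := suppPow_ofReal one_ne_zero (hA.eigenvalues_nonneg i)
  simpa using this

lemma cpow_zero (hA : A.PosDef) : cpow hA.posSemidef 0 = 1 := by
  rw [← spec_one hA.1]
  refine spec_congr hA.1 fun i => ?_
  simp [suppPow, (hA.eigenvalues_pos i).ne']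

lemma norm_cpow_le (hA : A.PosSemidef) {z : ℂ} (hz : z.re = 0) : ‖cpow hA z‖ ≤ 1 :=
  norm_spec_le hA.1 zero_le_one fun _ => norm_suppPow_le hz

lemma norm_cpow_le_re (hA : A.PosSemidef) (z : ℂ) : ‖cpow hA z‖ ≤ ‖cpow hA (z.re : ℂ)‖ := by
  have h : cpow hA z = cpow hA (z.re : ℂ) * cpow hA (z.im * Complex.I) := by
    rw [cpow_mul, Complex.re_add_im]
  rw [h]
  exact (norm_mul_le _ _).trans
    (mul_le_of_le_one_right (norm_nonneg _) (norm_cpow_le hA (by simp)))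

lemma differentiable_cpow (hA : A.PosSemidef) : Differentiable ℂ (cpow hA) := by
  have h : Differentiable ℂ fun z : ℂ => fun i => suppPow z (hA.1.eigenvalues i) := by
    refine differentiable_pi.2 fun i => ?_
    unfold suppPow
    split_ifs <;> fun_prop
  have hd : Differentiable ℂ fun z : ℂ =>
      (Matrix.diagonal fun i => suppPow z (hA.1.eigenvalues i) : Matrix (Fin n) (Fin n) ℂ) :=
    ((Matrix.diagonalLinearMap (Fin n) ℂ ℂ).toContinuousLinearMap.differentiable).comp h
  exact ((differentiable_const _).mul hd).mul (differentiable_const _)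

/-- The trace of the `r`-th power. -/
noncomputable def tracePow (hA : A.PosSemidef) (r : ℝ) : ℝ := ∑ i, hA.1.eigenvalues i ^ r

lemma trace_cpow (hA : A.PosSemidef) {r : ℝ} (hr : r ≠ 0) :
    (cpow hA r).trace = (tracePow hA r : ℂ) := by
  rw [cpow, trace_spec, tracePow, Complex.ofReal_sum]
  exact Finset.sum_congr rfl fun i _ => suppPow_ofReal hr (hA.eigenvalues_nonneg i)

lemma tracePow_nonneg (hA : A.PosSemidef) (r : ℝ) : 0 ≤ tracePow hA r :=
  Finset.sum_nonneg fun i _ => Real.rpow_nonneg (hA.eigenvalues_nonneg i) r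

lemma tracePow_pos (hA : A.PosSemidef) (h0 : A ≠ 0) (r : ℝ) : 0 < tracePow hA r := by
  obtain ⟨i, hi⟩ : ∃ i, hA.1.eigenvalues i ≠ 0 := by
    by_contra! h
    exact h0 (hA.1.eigenvalues_eq_zero_iff.1 (funext h))
  exact Finset.sum_pos' (fun i _ => Real.rpow_nonneg (hA.eigenvalues_nonneg i) r)
    ⟨i, Finset.mem_univ i,
      Real.rpow_pos_of_pos (lt_of_le_of_ne (hA.eigenvalues_nonneg i) (Ne.symm hi)) r⟩

lemma norm_trace_cpow_mul_le (hA : A.PosSemidef) {r : ℝ} (hr : r ≠ 0)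
    {C : Matrix (Fin n) (Fin n) ℂ} (hC : ‖C‖ ≤ 1) :
    ‖(cpow hA r * C).trace‖ ≤ tracePow hA r := by
  have h := norm_trace_spec_mul_le hA.1 (p := fun x => x ^ r)
    (fun i => Real.rpow_nonneg (hA.eigenvalues_nonneg i) r) hC
  rwa [← spec_congr hA.1 (g := suppPow r)
    fun i => suppPow_ofReal hr (hA.eigenvalues_nonneg i)] at h

lemma mul_cpow_eq_of_trace_eq (hA : A.PosSemidef) {r : ℝ} (hr : r ≠ 0)
    {C : Matrix (Fin n) (Fin n) ℂ} (hC : ‖C‖ ≤ 1)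
    (h : (cpow hA r * C).trace = (tracePow hA r : ℂ)) (w : ℂ) :
    C * cpow hA w = cpow hA w := by
  refine mul_spec_eq_of_trace_eq hA.1 (p := fun x => x ^ r)
    (fun i => Real.rpow_nonneg (hA.eigenvalues_nonneg i) r) hC ?_ fun i hi => ?_
  · rwa [← spec_congr hA.1 (g := suppPow r)
      fun i => suppPow_ofReal hr (hA.eigenvalues_nonneg i)]
  · have := (Real.rpow_eq_zero (hA.eigenvalues_nonneg i) hr).1 hi
    simp [suppPow, this]

end ComplexPowers

section Kraus

variable {n m : ℕ} {ι : Type*} [Fintype ι]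

/-- The linear map `X ↦ ∑ k, K k * X * (K k)ᴴ` with Kraus operators `K k`. -/
def kraus (K : ι → Matrix (Fin m) (Fin n) ℂ) :
    Matrix (Fin n) (Fin n) ℂ →ₗ[ℂ] Matrix (Fin m) (Fin m) ℂ where
  toFun X := ∑ k, K k * X * (K k)ᴴ
  map_add' X Y := by simp [Matrix.mul_add, Matrix.add_mul, Finset.sum_add_distrib]
  map_smul' c X := by simp [Finset.smul_sum]

lemma kraus_apply (K : ι → Matrix (Fin m) (Fin n) ℂ) (X : Matrix (Fin n) (Fin n) ℂ) :
    kraus K X = ∑ k, K k * X * (K k)ᴴ := rfl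

lemma kraus_posSemidef (K : ι → Matrix (Fin m) (Fin n) ℂ) {X : Matrix (Fin n) (Fin n) ℂ}
    (hX : X.PosSemidef) : (kraus K X).PosSemidef :=
  Matrix.posSemidef_sum _ fun k _ => hX.mul_mul_conjTranspose_same (K k)

lemma trace_kraus_mul (K : ι → Matrix (Fin m) (Fin n) ℂ) (X : Matrix (Fin n) (Fin n) ℂ)
    (B : Matrix (Fin m) (Fin m) ℂ) :
    (kraus K X * B).trace = (X * kraus (fun k => (K k)ᴴ) B).trace := by
  simp only [kraus_apply, Finset.sum_mul, Finset.mul_sum, Matrix.trace_sum,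
    Matrix.conjTranspose_conjTranspose]
  refine Finset.sum_congr rfl fun k _ => ?_
  rw [Matrix.mul_assoc, Matrix.mul_assoc, Matrix.trace_mul_comm]
  simp only [Matrix.mul_assoc]

lemma kraus_comp (K : ι → Matrix (Fin m) (Fin n) ℂ) (P : Matrix (Fin m) (Fin m) ℂ)
    (Q : Matrix (Fin n) (Fin n) ℂ) (X : Matrix (Fin n) (Fin n) ℂ) :
    kraus (fun k => P * K k * Q) X = P * kraus K (Q * X * Qᴴ) * Pᴴ := by
  simp only [kraus_apply, Matrix.mul_sum, Matrix.sum_mul, Matrix.conjTranspose_mul,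
    Matrix.mul_assoc]

lemma blockApply_kraus_posSemidef (K : ι → Matrix (Fin m) (Fin n) ℂ) (d : ℕ)
    {M : Matrix (Fin n × Fin d) (Fin n × Fin d) ℂ} (hM : M.PosSemidef) :
    (blockApply (kraus K) d M).PosSemidef := by
  let L : ι → Matrix (Fin m × Fin d) (Fin n × Fin d) ℂ :=
    fun k => Matrix.of fun p q => if p.2 = q.2 then K k p.1 q.1 else 0
  have h : blockApply (kraus K) d M = ∑ k, L k * M * (L k)ᴴ := by
    ext ⟨p, a⟩ ⟨q, b⟩
    simp only [blockApply, kraus_apply, Matrix.of_apply, Matrix.sum_apply, L]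
    refine Finset.sum_congr rfl fun k _ => ?_
    simp only [Matrix.mul_apply, Matrix.of_apply, Matrix.conjTranspose_apply,
      Fintype.sum_prod_type, ite_mul, zero_mul, Finset.sum_ite_eq, Finset.mem_univ, if_true]
    refine Finset.sum_congr rfl fun j _ => ?_
    rw [Finset.sum_eq_single b]
    · simp
    · intro c _ hc
      simp [Ne.symm hc]
    · simp
  rw [h]
  exact Matrix.posSemidef_sum _ fun k _ => hM.mul_mul_conjTranspose_same (L k)

lemma isQuantumChannel_kraus (K : ι → Matrix (Fin m) (Fin n) ℂ)
    (hK : ∑ k, (K k)ᴴ * K k = 1) : IsQuantumChannel (kraus K) := by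
  refine ⟨fun d _ M hM => blockApply_kraus_posSemidef K d hM, fun X => ?_⟩
  have h := trace_kraus_mul K X 1
  have h1 : kraus (fun k => (K k)ᴴ) 1 = (1 : Matrix (Fin n) (Fin n) ℂ) := by
    simpa [kraus_apply] using hK
  rwa [h1, mul_one, mul_one] at h

open scoped MatrixOrder in
lemma exists_eq_conjTranspose_mul_self {κ : Type*} [Fintype κ] [DecidableEq κ]
    {A : Matrix κ κ ℂ} (hA : A.PosSemidef) : ∃ B : Matrix κ κ ℂ, A = Bᴴ * B :=
  CStarAlgebra.nonneg_iff_eq_star_mul_self.1 (Matrix.nonneg_iff_posSemidef.2 hA)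

/-- Every completely positive map has a Kraus decomposition (via its Choi matrix). -/
lemma exists_kraus {Φ : Matrix (Fin n) (Fin n) ℂ →ₗ[ℂ] Matrix (Fin m) (Fin m) ℂ}
    (hn : 1 ≤ n) (hΦ : IsCompletelyPositive Φ) :
    ∃ K : Fin m × Fin n → Matrix (Fin m) (Fin n) ℂ, Φ = kraus K := by
  let v : Fin n × Fin n → ℂ := fun p => if p.1 = p.2 then 1 else 0
  have hC := hΦ n hn _ (Matrix.posSemidef_vecMulVec_self_star v)
  obtain ⟨B, hB⟩ := exists_eq_conjTranspose_mul_self hC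
  refine ⟨fun k => Matrix.of fun p a => star (B k (p, a)), ?_⟩
  refine LinearMap.ext fun X => ?_
  have hsingle : ∀ a b : Fin n, ∀ p q : Fin m,
      Φ (Matrix.single a b 1) p q = ∑ k, star (B k (p, a)) * B k (q, b) := by
    intro a b p q
    have h := congrFun (congrFun hB (p, a)) (q, b)
    rw [Matrix.mul_apply] at h
    simp only [Matrix.conjTranspose_apply] at h
    rw [← h]
    have : (Matrix.of fun i j => Matrix.vecMulVec v (star v) (i, a) (j, b)) =
        Matrix.single a b (1 : ℂ) := by
      ext i j
      simp only [Matrix.of_apply, Matrix.vecMulVec_apply, Pi.star_apply, Matrix.single_apply, v]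
      by_cases h1 : i = a <;> by_cases h2 : j = b <;> simp [h1, h2]
      all_goals aesop
    simp only [blockApply, Matrix.of_apply, this]
  ext p q
  conv_lhs => rw [Matrix.matrix_eq_sum_single X]
  simp only [map_sum, Matrix.sum_apply, kraus_apply]
  have h2 : ∀ a b, Φ (Matrix.single a b (X a b)) p q =
      ∑ k, star (B k (p, a)) * X a b * B k (q, b) := by
    intro a b
    have : Matrix.single a b (X a b) = X a b • Matrix.single a b (1 : ℂ) := by
      rw [Matrix.smul_single, smul_eq_mul, mul_one]
    rw [this, map_smul, Matrix.smul_apply, hsingle, smul_eq_mul, Finset.mul_sum]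
    exact Finset.sum_congr rfl fun k _ => by ring
  simp only [h2, Matrix.mul_apply, Matrix.of_apply, Matrix.conjTranspose_apply, star_star,
    Finset.sum_mul]
  calc ∑ a, ∑ b, ∑ k, star (B k (p, a)) * X a b * B k (q, b)
      = ∑ a, ∑ k, ∑ b, star (B k (p, a)) * X a b * B k (q, b) :=
        Finset.sum_congr rfl fun a _ => Finset.sum_comm
    _ = ∑ k, ∑ a, ∑ b, star (B k (p, a)) * X a b * B k (q, b) := Finset.sum_comm
    _ = ∑ k, ∑ b, ∑ a, star (B k (p, a)) * X a b * B k (q, b) :=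
        Finset.sum_congr rfl fun k _ => Finset.sum_comm

lemma sum_kraus_eq_one {K : ι → Matrix (Fin m) (Fin n) ℂ}
    (h : ∀ X, (kraus K X).trace = X.trace) : ∑ k, (K k)ᴴ * K k = 1 := by
  have h1 : kraus (fun k => (K k)ᴴ) 1 = ∑ k, (K k)ᴴ * K k := by simp [kraus_apply]
  rw [← h1]
  refine Matrix.ext_iff_trace_mul_left.2 fun X => ?_
  rw [← trace_kraus_mul, mul_one, mul_one, h]

/-- Unital completely positive maps are contractions for the operator norm. -/
lemma norm_kraus_le {K : ι → Matrix (Fin m) (Fin n) ℂ} (hK : kraus K 1 = 1)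
    {u : Matrix (Fin n) (Fin n) ℂ} (hu : ‖u‖ ≤ 1) : ‖kraus K u‖ ≤ 1 := by
  classical
  let V : Matrix (Fin n × ι) (Fin m) ℂ := Matrix.of fun p i => star (K p.2 i p.1)
  let D : Matrix (Fin n) (Fin n) ℂ →⋆ₙₐ[ℂ] Matrix (Fin n × ι) (Fin n × ι) ℂ :=
    { toFun := fun u => Matrix.blockDiagonal fun _ : ι => u
      map_smul' := fun c u => Matrix.blockDiagonal_smul c _
      map_zero' := Matrix.blockDiagonal_zero
      map_add' := fun u w => Matrix.blockDiagonal_add _ _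
      map_mul' := fun u w => Matrix.blockDiagonal_mul _ _
      map_star' := fun u => (Matrix.blockDiagonal_conjTranspose _).symm }
  have hV : ∀ u, kraus K u = Vᴴ * D u * V := by
    intro u
    change _ = Vᴴ * Matrix.blockDiagonal (fun _ : ι => u) * V
    ext i j
    simp only [kraus_apply, Matrix.sum_apply, Matrix.mul_apply, Matrix.conjTranspose_apply,
      Matrix.blockDiagonal_apply, Fintype.sum_prod_type, V, Matrix.of_apply, star_star,
      mul_ite, mul_zero, Finset.sum_ite_eq', Finset.mem_univ, if_true]
    rw [Finset.sum_comm]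
  have hV1 : Vᴴ * V = 1 := by
    rw [← hK, hV]
    have : D 1 = 1 := Matrix.blockDiagonal_one
    rw [this, Matrix.mul_one]
  have hVn : ‖V‖ ≤ 1 := by
    have h := V.l2_opNorm_conjTranspose_mul_self
    rw [hV1] at h
    have h1 : ‖(1 : Matrix (Fin m) (Fin m) ℂ)‖ ≤ 1 := by
      rcases subsingleton_or_nontrivial (Matrix (Fin m) (Fin m) ℂ) with h | h
      · simp [Subsingleton.elim (1 : Matrix (Fin m) (Fin m) ℂ) 0]
      · exact CStarRing.norm_one.le
    nlinarith [norm_nonneg V]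
  have hD : ‖D u‖ ≤ 1 := (NonUnitalStarAlgHom.norm_apply_le D u).trans hu
  rw [hV]
  have h3 : ‖Vᴴ‖ ≤ 1 := by rwa [Matrix.l2_opNorm_conjTranspose]
  have : ‖Vᴴ * D u * V‖ ≤ 1 * 1 * 1 :=
    (Matrix.l2_opNorm_mul _ _).trans (mul_le_mul ((Matrix.l2_opNorm_mul _ _).trans
      (mul_le_mul h3 hD (norm_nonneg _) zero_le_one)) hVn (norm_nonneg _) (by positivity))
  simpa using this

lemma trace_conjTranspose_mul_self_nonneg (P : Matrix (Fin m) (Fin n) ℂ) :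
    0 ≤ (Pᴴ * P).trace.re :=
  (Complex.le_def.1 (Matrix.posSemidef_conjTranspose_mul_self P).trace_nonneg).1

lemma sq_sum_trace_le (P R : ι → Matrix (Fin m) (Fin n) ℂ) :
    (∑ k, ((P k)ᴴ * R k).trace).re ^ 2 ≤
      (∑ k, ((P k)ᴴ * P k).trace).re * (∑ k, ((R k)ᴴ * R k).trace).re := by
  simp only [Complex.re_sum]
  have key : ∀ t : ℝ, 0 ≤ (∑ k, ((R k)ᴴ * R k).trace.re) * (t * t) +
      (2 * ∑ k, ((P k)ᴴ * R k).trace.re) * t + ∑ k, ((P k)ᴴ * P k).trace.re := by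
    intro t
    have h : 0 ≤ ∑ k, ((P k + (t : ℂ) • R k)ᴴ * (P k + (t : ℂ) • R k)).trace.re :=
      Finset.sum_nonneg fun k _ => trace_conjTranspose_mul_self_nonneg _
    refine h.trans_eq ?_
    rw [Finset.mul_sum, Finset.sum_mul, Finset.sum_mul, ← Finset.sum_add_distrib,
      ← Finset.sum_add_distrib]
    refine Finset.sum_congr rfl fun k _ => ?_
    have hs : ((R k)ᴴ * P k).trace.re = ((P k)ᴴ * R k).trace.re := by
      rw [← Complex.conj_re, ← Complex.star_def, ← Matrix.trace_conjTranspose,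
        Matrix.conjTranspose_mul, Matrix.conjTranspose_conjTranspose]
    simp only [Matrix.conjTranspose_add, Matrix.conjTranspose_smul, Matrix.add_mul, Matrix.mul_add,
      Matrix.trace_add, Matrix.smul_mul, Matrix.mul_smul, Matrix.trace_smul, Complex.add_re,
      smul_eq_mul, Complex.star_def, Complex.conj_ofReal, Complex.re_ofReal_mul, hs]
    ring
  have := discrim_le_zero key
  rw [discrim] at this
  nlinarith

/-- Schwarz inequality for a unital completely positive map, tested on traces. -/
lemma sq_trace_le_kraus {K : ι → Matrix (Fin m) (Fin n) ℂ} (hK : ∑ k, (K k)ᴴ * K k = 1)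
    {h a : Matrix (Fin m) (Fin m) ℂ} (hha : h * aᴴ = 1) (S T : Matrix (Fin n) (Fin n) ℂ) :
    (Sᴴ * T).trace.re ^ 2 ≤ (hᴴ * kraus K (S * Sᴴ) * h).trace.re *
      (Tᴴ * kraus (fun k => (K k)ᴴ) (a * aᴴ) * T).trace.re := by
  have h1 : ∑ k, ((hᴴ * K k * S)ᴴ * (aᴴ * K k * T)).trace = (Sᴴ * T).trace := by
    have : ∀ k, (hᴴ * K k * S)ᴴ * (aᴴ * K k * T) = Sᴴ * ((K k)ᴴ * K k) * T := by
      intro k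
      simp only [Matrix.conjTranspose_mul, Matrix.conjTranspose_conjTranspose, Matrix.mul_assoc]
      rw [← Matrix.mul_assoc h, hha, Matrix.one_mul]
    simp only [this]
    rw [← Matrix.trace_sum, ← Matrix.sum_mul, ← Matrix.mul_sum, hK, Matrix.mul_one]
  have h2 : ∑ k, ((hᴴ * K k * S)ᴴ * (hᴴ * K k * S)).trace =
      (hᴴ * kraus K (S * Sᴴ) * h).trace := by
    rw [kraus_apply, Matrix.mul_sum, Matrix.sum_mul, Matrix.trace_sum]
    refine Finset.sum_congr rfl fun k _ => ?_
    rw [Matrix.trace_mul_comm]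
    simp only [Matrix.conjTranspose_mul, Matrix.conjTranspose_conjTranspose, Matrix.mul_assoc]
  have h3 : ∑ k, ((aᴴ * K k * T)ᴴ * (aᴴ * K k * T)).trace =
      (Tᴴ * kraus (fun k => (K k)ᴴ) (a * aᴴ) * T).trace := by
    rw [kraus_apply, Matrix.mul_sum, Matrix.sum_mul, Matrix.trace_sum]
    refine Finset.sum_congr rfl fun k _ => ?_
    simp only [Matrix.conjTranspose_mul, Matrix.conjTranspose_conjTranspose, Matrix.mul_assoc]
  have := sq_sum_trace_le (fun k => hᴴ * K k * S) (fun k => aᴴ * K k * T)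
  rwa [h1, h2, h3] at this

end Kraus

section ComplexAnalysis

open Complex.HadamardThreeLines

/-- An entire function bounded by `a` on the boundary of the strip `0 ≤ re z ≤ 1` whose value at an
interior point has real part at least `a` is constant. -/
lemma eq_const_of_three_lines {f : ℂ → ℂ} (hf : Differentiable ℂ f) {a θ : ℝ} (ha : 0 < a)
    (hθ0 : 0 < θ) (hθ1 : θ < 1) (hB : BddAbove ((norm ∘ f) '' verticalClosedStrip 0 1))
    (h0 : ∀ z : ℂ, z.re = 0 → ‖f z‖ ≤ a) (h1 : ∀ z : ℂ, z.re = 1 → ‖f z‖ ≤ a)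
    (h : a ≤ (f θ).re) (z : ℂ) : f z = a := by
  have hle : ∀ z ∈ verticalClosedStrip 0 1, ‖f z‖ ≤ a := by
    intro z hz
    have := norm_le_interp_of_mem_verticalClosedStrip₀₁' f hz hf.diffContOnCl hB h0 h1
    rwa [← Real.rpow_add ha, sub_add_cancel, Real.rpow_one] at this
  have hθc : (θ : ℂ) ∈ verticalClosedStrip 0 1 := by
    simp [verticalClosedStrip, hθ0.le, hθ1.le]
  have hθo : (θ : ℂ) ∈ verticalStrip 0 1 := by
    simp [verticalStrip, hθ0, hθ1]
  have hθa : f θ = a := by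
    have h2 := hle _ hθc
    have h3 : ‖f θ‖ ^ 2 = (f θ).re ^ 2 + (f θ).im ^ 2 := by
      rw [Complex.sq_norm, Complex.normSq_apply]; ring
    have h4 : ‖f θ‖ ^ 2 ≤ a ^ 2 := by gcongr
    have h5 : (f θ).re ≤ a := (Complex.re_le_norm _).trans h2
    have h6 : (f θ).re = a := le_antisymm h5 h
    apply Complex.ext
    · simpa using h6
    · simp only [Complex.ofReal_im]
      rw [h6] at h3
      nlinarith [sq_nonneg (f θ).im]
  have hsub : verticalStrip 0 1 ⊆ verticalClosedStrip 0 1 :=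
    Set.preimage_mono Set.Ioo_subset_Icc_self
  have hopen : IsOpen (verticalStrip 0 1) := isOpen_Ioo.preimage Complex.continuous_re
  have hconn : IsPreconnected (verticalStrip 0 1) :=
    ((convex_Ioo (0 : ℝ) 1).linear_preimage Complex.reLm).isPreconnected
  have hmax : IsMaxOn (norm ∘ f) (verticalStrip 0 1) θ := by
    intro w hw
    simp only [Set.mem_ofPred_eq, Function.comp_apply, hθa, Complex.norm_real,
      Real.norm_of_nonneg ha.le]
    exact hle w (hsub hw)
  have heq := Complex.eqOn_of_isPreconnected_of_isMaxOn_norm hconn hopen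
    hf.differentiableOn hθo hmax
  have hev : f =ᶠ[nhds (θ : ℂ)] fun _ => (a : ℂ) := by
    filter_upwards [hopen.mem_nhds hθo] with w hw
    rw [heq hw, Function.const, hθa]
  have := AnalyticOnNhd.eq_of_eventuallyEq
    (fun w _ => hf.analyticAt w) (fun w _ => analyticAt_const) hev
  exact congrFun this z

/-- Entire functions that agree on the imaginary axis are equal. -/
lemma eq_of_eq_on_imaginary_axis {E : Type*} [NormedAddCommGroup E] [NormedSpace ℂ E]
    [CompleteSpace E] {F G : ℂ → E} (hF : Differentiable ℂ F) (hG : Differentiable ℂ G)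
    (h : ∀ z : ℂ, z.re = 0 → F z = G z) : F = G := by
  refine AnalyticOnNhd.eq_of_frequently_eq (z₀ := 0)
    (fun w _ => hF.analyticAt w) (fun w _ => hG.analyticAt w) ?_
  have ht : Filter.Tendsto (fun t : ℝ => (t : ℂ) * Complex.I) (nhdsWithin 0 {0}ᶜ)
      (nhdsWithin 0 {0}ᶜ) := by
    refine tendsto_nhdsWithin_of_tendsto_nhds_of_eventually_within _ ?_ ?_
    · have : Continuous fun t : ℝ => (t : ℂ) * Complex.I := by fun_prop
      exact (by simpa using this.tendsto 0 : Filter.Tendsto _ _ _).mono_left nhdsWithin_le_nhds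
    · filter_upwards [self_mem_nhdsWithin] with t ht
      simpa using ht
  exact ht.frequently (Filter.Eventually.frequently
    (Filter.Eventually.of_forall fun t => h _ (by simp)))

end ComplexAnalysis

section Interpolation

variable {n m : ℕ} {ι : Type*} [Fintype ι] (K : ι → Matrix (Fin m) (Fin n) ℂ)
  {σ Y : Matrix (Fin n) (Fin n) ℂ} {τ X : Matrix (Fin m) (Fin m) ℂ}
  (hσ : σ.PosSemidef) (hτ : τ.PosSemidef) (hX : X.PosSemidef) (hY : Y.PosSemidef) (α : ℝ)

/-- The entire family interpolating between the adjoint channel and the Petz recovery map. -/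
noncomputable def interp (z : ℂ) : Matrix (Fin n) (Fin n) ℂ :=
  cpow hσ (z / 2) * kraus (fun k => (K k)ᴴ)
    (cpow hτ (-(z / 2)) * cpow hX (α * z) * cpow hτ (-(z / 2))) * cpow hσ (z / 2)

/-- The pairing of `interp` with the complex powers of `Y`. -/
noncomputable def pairing (z : ℂ) : ℂ :=
  (cpow hY (α * (1 - z)) * interp K hσ hτ hX α z).trace

lemma differentiable_linearMap_comp {p q : ℕ}
    (L : Matrix (Fin p) (Fin p) ℂ →ₗ[ℂ] Matrix (Fin q) (Fin q) ℂ)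
    {F : ℂ → Matrix (Fin p) (Fin p) ℂ} (hF : Differentiable ℂ F) :
    Differentiable ℂ fun z => L (F z) :=
  L.toContinuousLinearMap.differentiable.comp hF

lemma differentiable_interp : Differentiable ℂ (interp K hσ hτ hX α) := by
  have h1 : Differentiable ℂ fun z : ℂ => cpow hσ (z / 2) :=
    (differentiable_cpow hσ).comp (by fun_prop)
  have h2 : Differentiable ℂ fun z : ℂ => cpow hτ (-(z / 2)) :=
    (differentiable_cpow hτ).comp (by fun_prop)
  have h3 : Differentiable ℂ fun z : ℂ => cpow hX (α * z) :=
    (differentiable_cpow hX).comp (by fun_prop)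
  exact (h1.mul (differentiable_linearMap_comp _ ((h2.mul h3).mul h2))).mul h1

lemma differentiable_pairing : Differentiable ℂ (pairing K hσ hτ hX hY α) := by
  have h1 : Differentiable ℂ fun z : ℂ => cpow hY (α * (1 - z)) :=
    (differentiable_cpow hY).comp (by fun_prop)
  exact ((Matrix.traceLinearMap (Fin n) ℂ ℂ).toContinuousLinearMap.differentiable).comp
    (h1.mul (differentiable_interp K hσ hτ hX α))

lemma continuous_norm_cpow {p : ℕ} {A : Matrix (Fin p) (Fin p) ℂ} (hA : A.PosSemidef)
    {g : ℝ → ℂ} (hg : Continuous g) : Continuous fun x => ‖cpow hA (g x)‖ :=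
  ((differentiable_cpow hA).continuous.comp hg).norm

lemma norm_mul_le_mul {p : ℕ} {A B : Matrix (Fin p) (Fin p) ℂ} {a b : ℝ} (hA : ‖A‖ ≤ a)
    (hB : ‖B‖ ≤ b) : ‖A * B‖ ≤ a * b :=
  (norm_mul_le _ _).trans (mul_le_mul hA hB (norm_nonneg _) ((norm_nonneg _).trans hA))

lemma bddAbove_pairing : BddAbove ((norm ∘ pairing K hσ hτ hX hY α) ''
    Complex.HadamardThreeLines.verticalClosedStrip 0 1) := by
  let tr := (Matrix.traceLinearMap (Fin n) ℂ ℂ).toContinuousLinearMap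
  let L := (kraus fun k => (K k)ᴴ).toContinuousLinearMap
  let B : ℝ → ℝ := fun x => ‖tr‖ * (‖cpow hY ((α * (1 - x) : ℝ) : ℂ)‖ *
    (‖cpow hσ ((x / 2 : ℝ) : ℂ)‖ * (‖L‖ * (‖cpow hτ ((-(x / 2) : ℝ) : ℂ)‖ *
      ‖cpow hX ((α * x : ℝ) : ℂ)‖ * ‖cpow hτ ((-(x / 2) : ℝ) : ℂ)‖)) *
        ‖cpow hσ ((x / 2 : ℝ) : ℂ)‖))
  have hBc : Continuous B := by
    have c1 : Continuous fun x : ℝ => ‖cpow hY ((α * (1 - x) : ℝ) : ℂ)‖ :=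
      continuous_norm_cpow hY (by fun_prop)
    have c2 : Continuous fun x : ℝ => ‖cpow hσ ((x / 2 : ℝ) : ℂ)‖ :=
      continuous_norm_cpow hσ (by fun_prop)
    have c3 : Continuous fun x : ℝ => ‖cpow hτ ((-(x / 2) : ℝ) : ℂ)‖ :=
      continuous_norm_cpow hτ (by fun_prop)
    have c4 : Continuous fun x : ℝ => ‖cpow hX ((α * x : ℝ) : ℂ)‖ :=
      continuous_norm_cpow hX (by fun_prop)
    exact continuous_const.mul
      (c1.mul ((c2.mul (continuous_const.mul ((c3.mul c4).mul c3))).mul c2))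
  obtain ⟨c, hc⟩ := isCompact_Icc.bddAbove_image (hBc.continuousOn (s := Set.Icc 0 1))
  refine ⟨c, ?_⟩
  rintro _ ⟨z, hz, rfl⟩
  refine le_trans ?_ (hc ⟨z.re, hz, rfl⟩)
  have e1 := norm_cpow_le_re hY (α * (1 - z))
  have e2 := norm_cpow_le_re hσ (z / 2)
  have e3 := norm_cpow_le_re hτ (-(z / 2))
  have e4 := norm_cpow_le_re hX (α * z)
  have r1 : ((α : ℂ) * (1 - z)).re = α * (1 - z.re) := by simp
  have r2 : (z / 2).re = z.re / 2 := by simp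
  have r3 : (-(z / 2)).re = -(z.re / 2) := by simp
  have r4 : ((α : ℂ) * z).re = α * z.re := by simp
  rw [r1] at e1
  rw [r2] at e2
  rw [r3] at e3
  rw [r4] at e4
  have hm := norm_mul_le_mul (norm_mul_le_mul e3 e4) e3
  have hL : ‖kraus (fun k => (K k)ᴴ) _‖ ≤ _ :=
    (L.le_opNorm _).trans (mul_le_mul_of_nonneg_left hm (norm_nonneg L))
  have hi := norm_mul_le_mul e1 (norm_mul_le_mul (norm_mul_le_mul e2 hL) e2)
  exact (tr.le_opNorm _).trans (mul_le_mul_of_nonneg_left hi (norm_nonneg tr))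

lemma norm_mul_le_one {p : ℕ} {A B : Matrix (Fin p) (Fin p) ℂ} (hA : ‖A‖ ≤ 1) (hB : ‖B‖ ≤ 1) :
    ‖A * B‖ ≤ 1 :=
  (norm_mul_le_mul hA hB).trans_eq (one_mul 1)

variable {K}

lemma norm_interp_le (hK : ∑ k, (K k)ᴴ * K k = 1) {z : ℂ} (hz : z.re = 0) :
    ‖interp K hσ hτ hX α z‖ ≤ 1 := by
  have hK1 : kraus (fun k => (K k)ᴴ) 1 = 1 := by simpa [kraus_apply] using hK
  have h1 : ‖cpow hσ (z / 2)‖ ≤ 1 := norm_cpow_le hσ (by simp [hz])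
  have h2 : ‖cpow hτ (-(z / 2))‖ ≤ 1 := norm_cpow_le hτ (by simp [hz])
  have h3 : ‖cpow hX (α * z)‖ ≤ 1 := norm_cpow_le hX (by simp [hz])
  exact norm_mul_le_one (norm_mul_le_one h1
    (norm_kraus_le hK1 (norm_mul_le_one (norm_mul_le_one h2 h3) h2))) h1

variable {α}

lemma norm_pairing_le_left (hK : ∑ k, (K k)ᴴ * K k = 1) (hα : α ≠ 0) {z : ℂ} (hz : z.re = 0) :
    ‖pairing K hσ hτ hX hY α z‖ ≤ tracePow hY α := by
  have h : cpow hY (α * (1 - z)) = cpow hY α * cpow hY (-(α * z)) := by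
    rw [cpow_mul]; ring_nf
  rw [pairing, h, mul_assoc]
  exact norm_trace_cpow_mul_le hY hα (norm_mul_le_one (norm_cpow_le hY (by simp [hz]))
    (norm_interp_le hσ hτ hX α hK hz))

lemma cpow_neg_half_mul_mul {p : ℕ} {A : Matrix (Fin p) (Fin p) ℂ} (hA : A.PosDef) :
    cpow hA.posSemidef (-(1 / 2)) * A * cpow hA.posSemidef (-(1 / 2)) = 1 := by
  rw [← congrArg (cpow hA.posSemidef (-(1 / 2)) * · * cpow hA.posSemidef (-(1 / 2)))
    (cpow_one hA.posSemidef), cpow_mul, cpow_mul, ← cpow_zero hA]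
  congr 1
  ring

lemma norm_pairing_le_right (hτ' : τ.PosDef) (hKσ : kraus K σ = τ) (hα : α ≠ 0)
    {z : ℂ} (hz : z.re = 1) :
    ‖pairing K hσ hτ'.posSemidef hX hY α z‖ ≤ tracePow hX α := by
  set hτ := hτ'.posSemidef
  obtain ⟨w, rfl⟩ : ∃ w, z = 1 + w := ⟨z - 1, by ring⟩
  have hw : w.re = 0 := by simpa using hz
  set S := cpow hσ (1 / 2)
  set T := cpow hτ (-(1 / 2))
  set s := cpow hσ (w / 2)
  set t := cpow hτ (-(w / 2))
  set y := cpow hY (-(α * w))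
  have hS : S * S = σ := by
    rw [cpow_mul, add_halves, cpow_one]
  have hSs : cpow hσ ((1 + w) / 2) = S * s := by
    rw [cpow_mul]; ring_nf
  have hsS : cpow hσ ((1 + w) / 2) = s * S := by
    rw [cpow_mul]; ring_nf
  have hTt : cpow hτ (-((1 + w) / 2)) = T * t := by
    rw [cpow_mul]; ring_nf
  have htT : cpow hτ (-((1 + w) / 2)) = t * T := by
    rw [cpow_mul]; ring_nf
  have hx : cpow hX (α * (1 + w)) = cpow hX α * cpow hX (α * w) := by
    rw [cpow_mul]; ring_nf
  have hy : cpow hY (α * (1 - (1 + w))) = y := by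
    simp only [y]; ring_nf
  have hSh : Sᴴ = S := by simp [S, cpow_conjTranspose]
  have hTh : Tᴴ = T := by simp [T, cpow_conjTranspose]
  let R : ι → Matrix (Fin m) (Fin n) ℂ := fun k => T * K k * S
  have hR : ∀ u, kraus R u = T * kraus K (S * u * S) * T := by
    intro u
    rw [kraus_comp, hSh, hTh]
  have hR1 : kraus R 1 = 1 := by
    rw [hR, mul_one, hS, hKσ, cpow_neg_half_mul_mul hτ']
  have key : pairing K hσ hτ hX hY α (1 + w) =
      (cpow hX α * (cpow hX (α * w) * (t * kraus R (s * y * s) * t))).trace := by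
    rw [pairing, interp, hy, hx]
    nth_rewrite 1 [hsS]
    rw [hSs, hTt]
    nth_rewrite 2 [← hTt]
    rw [htT]
    set Z := cpow hX α * cpow hX (α * w)
    calc (y * (s * S * kraus (fun k => (K k)ᴴ) (T * t * Z * (t * T)) * (S * s))).trace
        = ((S * (s * y * s) * S) * kraus (fun k => (K k)ᴴ) (T * t * Z * (t * T))).trace := by
          rw [← Matrix.trace_mul_comm (kraus _ _)]
          have : y * (s * S * kraus (fun k => (K k)ᴴ) (T * t * Z * (t * T)) * (S * s)) =
              (y * s * S) * (kraus (fun k => (K k)ᴴ) (T * t * Z * (t * T)) * (S * s)) := by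
            simp only [mul_assoc]
          rw [this, Matrix.trace_mul_comm]
          simp only [mul_assoc]
      _ = (kraus K (S * (s * y * s) * S) * (T * t * Z * (t * T))).trace :=
          (trace_kraus_mul K _ _).symm
      _ = (Z * (t * kraus R (s * y * s) * t)).trace := by
          rw [hR, ← Matrix.trace_mul_comm (t * _ * t)]
          have : kraus K (S * (s * y * s) * S) * (T * t * Z * (t * T)) =
              kraus K (S * (s * y * s) * S) * T * t * Z * (t * T) := by
            simp only [mul_assoc]
          rw [this, Matrix.trace_mul_comm]
          simp only [mul_assoc]
      _ = _ := by simp only [Z, mul_assoc]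
  have hs1 : ‖s‖ ≤ 1 := norm_cpow_le hσ (by simp [hw])
  have ht1 : ‖t‖ ≤ 1 := norm_cpow_le hτ (by simp [hw])
  have hy1 : ‖y‖ ≤ 1 := norm_cpow_le hY (by simp [hw])
  have hx1 : ‖cpow hX (α * w)‖ ≤ 1 := norm_cpow_le hX (by simp [hw])
  rw [key]
  exact norm_trace_cpow_mul_le hX hα (norm_mul_le_one hx1 (norm_mul_le_one (norm_mul_le_one ht1
    (norm_kraus_le hR1 (norm_mul_le_one (norm_mul_le_one hs1 hy1) hs1))) ht1))

end Interpolation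

section Schwarz

variable {n m : ℕ}

lemma star_suppPow_ofReal (r x : ℝ) : star (suppPow r x) = suppPow r x := by
  rw [star_suppPow, Complex.star_def, Complex.conj_ofReal]

/-- `suppPow r`, modified to take the value `c` at `0`. -/
noncomputable def fullPow (r c x : ℝ) : ℂ :=
  suppPow r x + c * if x = 0 then 1 else 0

lemma star_fullPow (r c x : ℝ) : star (fullPow r c x) = fullPow r c x := by
  rw [fullPow, star_add, star_suppPow_ofReal]
  split_ifs <;> simp

lemma fullPow_mul_fullPow_neg (r : ℝ) {c : ℝ} (hc : c ≠ 0) (x : ℝ) :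
    fullPow (-r) c⁻¹ x * fullPow r c x = 1 := by
  by_cases hx : x = 0
  · have : (c : ℂ) ≠ 0 := by exact_mod_cast hc
    simp [fullPow, suppPow, hx, this]
  · simp only [fullPow, hx, if_false, mul_zero, add_zero]
    rw [suppPow_mul]
    simp [suppPow, hx]

lemma fullPow_mul_self (r c x : ℝ) :
    fullPow r c x * fullPow r c x =
      suppPow (2 * r : ℝ) x + (c ^ 2 : ℝ) * if x = 0 then 1 else 0 := by
  by_cases hx : x = 0
  · simp [fullPow, suppPow, hx, sq]
  · simp only [fullPow, hx, if_false, mul_zero, add_zero]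
    rw [suppPow_mul]
    push_cast
    rw [two_mul]

lemma fullPow_mul_id_mul (r c : ℝ) {x : ℝ} (hx : 0 ≤ x) :
    fullPow r c x * x * fullPow r c x = suppPow (2 * r + 1 : ℝ) x := by
  rcases eq_or_ne x 0 with h | h
  · simp [h, suppPow]
  · have h1 : (x : ℂ) = suppPow (1 : ℝ) x := by rw [suppPow_ofReal one_ne_zero hx, Real.rpow_one]
    simp only [fullPow, h, if_false, mul_zero, add_zero]
    rw [h1, suppPow_mul, suppPow_mul]
    push_cast
    ring_nf

variable {A : Matrix (Fin n) (Fin n) ℂ}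

lemma spec_fullPow_conjTranspose (hA : A.IsHermitian) (r c : ℝ) :
    (spec hA (fullPow r c))ᴴ = spec hA (fullPow r c) := by
  rw [spec_conjTranspose]
  simp only [star_fullPow]

lemma cpow_conjTranspose_ofReal (hA : A.PosSemidef) (r : ℝ) : (cpow hA r)ᴴ = cpow hA r := by
  rw [cpow_conjTranspose, Complex.star_def, Complex.conj_ofReal]

lemma cpow_mul_ofReal (hA : A.PosSemidef) (r t : ℝ) :
    cpow hA r * cpow hA t = cpow hA (r + t : ℝ) := by
  rw [cpow_mul, Complex.ofReal_add]

lemma cpow_mul_cpow_neg (hA : A.PosDef) (z : ℂ) :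
    cpow hA.posSemidef z * cpow hA.posSemidef (-z) = 1 := by
  rw [cpow_mul, add_neg_cancel, cpow_zero hA]

lemma cpow_neg_mul_cpow (hA : A.PosDef) (z : ℂ) :
    cpow hA.posSemidef (-z) * cpow hA.posSemidef z = 1 := by
  rw [cpow_mul, neg_add_cancel, cpow_zero hA]

variable {ι : Type*} [Fintype ι] {K : ι → Matrix (Fin m) (Fin n) ℂ}
  {σ ρ Y : Matrix (Fin n) (Fin n) ℂ} {τ X : Matrix (Fin m) (Fin m) ℂ}

lemma sq_tracePow_le (hK : ∑ k, (K k)ᴴ * K k = 1) (hσ : σ.PosDef) (hτ : τ.PosDef)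
    (hX : X.PosSemidef) (hY : Y.PosSemidef) {α s : ℝ} (hα : α ≠ 0) (hs : α * (1 + 2 * s) = 1)
    (hYρ : Y = cpow hσ.posSemidef s * ρ * cpow hσ.posSemidef s)
    (hXρ : X = cpow hτ.posSemidef s * kraus K ρ * cpow hτ.posSemidef s) :
    tracePow hY α ^ 2 ≤ tracePow hX α *
      (pairing K hσ.posSemidef hτ.posSemidef hX hY α (2 * s : ℝ)).re := by
  set hσ' := hσ.posSemidef
  set hτ' := hτ.posSemidef
  let q := cpow hY (α - 1 / 2 : ℝ)
  let E := spec hX.1 fun x => if x = 0 then 1 else 0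
  let d := (q * cpow hσ' s * kraus (fun k => (K k)ᴴ) (cpow hτ' (-s) * E * cpow hτ' (-s)) *
    (cpow hσ' s * q)).trace.re
  have key : ∀ c : ℝ, 0 < c → tracePow hY α ^ 2 ≤ tracePow hX α *
      ((pairing K hσ' hτ' hX hY α (2 * s : ℝ)).re + c ^ 2 * d) := by
    intro c hc
    have hst : (-s : ℂ) = (-s : ℝ) := by simp
    have h1 := cpow_mul_cpow_neg hσ s
    have h1' := cpow_neg_mul_cpow hσ s
    have h2 := cpow_mul_cpow_neg hτ s
    let g := spec hX.1 (fullPow (-((1 - α) / 2)) c⁻¹)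
    let f := spec hX.1 (fullPow ((1 - α) / 2) c)
    have hgf : g * f = 1 := by
      rw [spec_mul, ← spec_one hX.1]
      exact spec_congr _ fun i => fullPow_mul_fullPow_neg _ hc.ne' _
    have hff : f * f = cpow hX (1 - α : ℝ) + ((c ^ 2 : ℝ) : ℂ) • E := by
      rw [spec_mul, cpow, ← spec_add_smul]
      refine spec_congr _ fun i => ?_
      rw [fullPow_mul_self]
      congr 3
      ring
    have hgXg : (g * X * g).trace = (tracePow hX α : ℂ) := by
      have : g * X * g = cpow hX α := by
        rw [← congrArg (g * · * g) (spec_id hX.1), spec_mul, spec_mul]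
        refine spec_congr _ fun i => ?_
        rw [fullPow_mul_id_mul _ _ (hX.eigenvalues_nonneg i)]
        congr 2
        ring
      rw [this, trace_cpow hX hα]
    have hgh : gᴴ = g := spec_fullPow_conjTranspose _ _ _
    have hfh : fᴴ = f := spec_fullPow_conjTranspose _ _ _
    have hsh : (cpow hσ' s)ᴴ = cpow hσ' s := cpow_conjTranspose_ofReal _ _
    have hsh' : (cpow hσ' (-s))ᴴ = cpow hσ' (-s) := by rw [hst, cpow_conjTranspose_ofReal]
    have hth : (cpow hτ' s)ᴴ = cpow hτ' s := cpow_conjTranspose_ofReal _ _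
    have hth' : (cpow hτ' (-s))ᴴ = cpow hτ' (-s) := by rw [hst, cpow_conjTranspose_ofReal]
    have hqh : qᴴ = q := cpow_conjTranspose_ofReal _ _
    let p := cpow hY (1 / 2 : ℝ)
    have hph : pᴴ = p := cpow_conjTranspose_ofReal _ _
    have hpp : p * p = Y := by
      rw [cpow_mul_ofReal]; norm_num; exact cpow_one hY
    have hha : (cpow hτ' s * g) * (cpow hτ' (-s) * f)ᴴ = 1 := by
      rw [conjTranspose_mul, hfh, hth', mul_assoc, ← mul_assoc g, hgf, one_mul, h2]
    have main := sq_trace_le_kraus hK hha (cpow hσ' (-s) * p) (cpow hσ' s * q)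
    have m1 : (cpow hσ' (-s) * p)ᴴ * (cpow hσ' s * q) = cpow hY α := by
      rw [conjTranspose_mul, hph, hsh', mul_assoc, ← mul_assoc (cpow hσ' (-s)), h1', one_mul,
        cpow_mul_ofReal]
      congr 2; ring
    have m2 : (cpow hσ' (-s) * p) * (cpow hσ' (-s) * p)ᴴ = ρ := by
      rw [conjTranspose_mul, hph, hsh', mul_assoc, ← mul_assoc p, hpp, hYρ]
      simp only [← mul_assoc]
      rw [h1', one_mul, mul_assoc, h1, mul_one]
    have m3 : (cpow hτ' s * g)ᴴ * kraus K ρ * (cpow hτ' s * g) = g * X * g := by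
      rw [conjTranspose_mul, hgh, hth, hXρ]
      simp only [mul_assoc]
    have m4 : (cpow hτ' (-s) * f) * (cpow hτ' (-s) * f)ᴴ =
        cpow hτ' (-s) * cpow hX (1 - α : ℝ) * cpow hτ' (-s) +
          ((c ^ 2 : ℝ) : ℂ) • (cpow hτ' (-s) * E * cpow hτ' (-s)) := by
      rw [conjTranspose_mul, hfh, hth', mul_assoc, ← mul_assoc f, hff, ← mul_assoc, mul_add,
        add_mul, mul_smul_comm, smul_mul_assoc]
    have m5 : (pairing K hσ' hτ' hX hY α (2 * s : ℝ)) = (q * cpow hσ' s *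
        kraus (fun k => (K k)ᴴ) (cpow hτ' (-s) * cpow hX (1 - α : ℝ) * cpow hτ' (-s)) *
          (cpow hσ' s * q)).trace := by
      have e1 : ((2 * s : ℝ) : ℂ) / 2 = s := by push_cast; ring
      have e2 : (α : ℂ) * (2 * s : ℝ) = (1 - α : ℝ) := by
        norm_cast
        linarith
      have e3 : cpow hY (α * (1 - (2 * s : ℝ))) = q * q := by
        rw [cpow_mul_ofReal]
        congr 1
        norm_cast
        linarith
      rw [pairing, interp, e1, e2, e3, mul_assoc q q, trace_mul_comm]
      simp only [mul_assoc]
    rw [m1, m2, m3, hgXg, m4, trace_cpow hY hα, conjTranspose_mul, hsh, hqh, map_add, map_smul,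
      mul_add, add_mul, trace_add, mul_smul_comm, smul_mul_assoc, trace_smul, ← m5,
      Complex.add_re, smul_eq_mul, Complex.re_ofReal_mul] at main
    exact main
  have ht : Filter.Tendsto (fun c : ℝ => tracePow hX α *
      ((pairing K hσ' hτ' hX hY α (2 * s : ℝ)).re + c ^ 2 * d)) (nhdsWithin 0 (Set.Ioi 0))
      (nhds (tracePow hX α * (pairing K hσ' hτ' hX hY α (2 * s : ℝ)).re)) := by
    have hc : Continuous fun c : ℝ => tracePow hX α *
      ((pairing K hσ' hτ' hX hY α (2 * s : ℝ)).re + c ^ 2 * d) := by fun_prop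
    exact (by simpa using hc.tendsto 0 : Filter.Tendsto _ _ _).mono_left nhdsWithin_le_nhds
  exact ge_of_tendsto ht (by filter_upwards [self_mem_nhdsWithin] with c hc using key c hc)

end Schwarz

section Monotonicity

variable {n m : ℕ} {ι : Type*} [Fintype ι] {K : ι → Matrix (Fin m) (Fin n) ℂ}
  {σ ρ Y : Matrix (Fin n) (Fin n) ℂ} {τ X : Matrix (Fin m) (Fin m) ℂ} {α s : ℝ}

/-- Data processing inequality, in terms of the trace functionals. -/
lemma tracePow_le (hK : ∑ k, (K k)ᴴ * K k = 1) (hσ : σ.PosDef) (hτ : τ.PosDef)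
    (hKσ : kraus K σ = τ) (hX : X.PosSemidef) (hY : Y.PosSemidef) (hα : α ≠ 0)
    (hs : α * (1 + 2 * s) = 1) (hs0 : 0 < 2 * s) (hs1 : 2 * s < 1)
    (hYρ : Y = cpow hσ.posSemidef s * ρ * cpow hσ.posSemidef s)
    (hXρ : X = cpow hτ.posSemidef s * kraus K ρ * cpow hτ.posSemidef s) :
    tracePow hY α ≤ tracePow hX α := by
  by_contra! hlt
  have hX0 := tracePow_nonneg hX α
  have hY0 := hX0.trans_lt hlt
  have h1 := sq_tracePow_le hK hσ hτ hX hY hα hs hYρ hXρ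
  have h2 := Complex.HadamardThreeLines.norm_le_interp_of_mem_verticalClosedStrip₀₁'
    (pairing K hσ.posSemidef hτ.posSemidef hX hY α) (z := (2 * s : ℝ))
    (by simp only [Complex.HadamardThreeLines.verticalClosedStrip, Set.mem_preimage,
      Complex.ofReal_re]; exact ⟨hs0.le, hs1.le⟩)
    (differentiable_pairing K _ _ hX hY α).diffContOnCl (bddAbove_pairing K _ _ hX hY α)
    (fun z hz => norm_pairing_le_left _ _ hX hY hK hα hz)
    (fun z hz => norm_pairing_le_right hσ.posSemidef hX hY hτ hKσ hα hz)
  rw [Complex.ofReal_re] at h2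
  have h3 : tracePow hY α ^ (1 - 2 * s) * tracePow hX α ^ (2 * s) ≤ tracePow hY α := by
    calc _ ≤ tracePow hY α ^ (1 - 2 * s) * tracePow hY α ^ (2 * s) := by gcongr
      _ = tracePow hY α := by rw [← Real.rpow_add hY0]; simp
  have h4 := mul_le_mul_of_nonneg_left (((Complex.re_le_norm _).trans h2).trans h3) hX0
  nlinarith

/-- If the data processing inequality is saturated then `pairing` is constant. -/
lemma pairing_eq (hK : ∑ k, (K k)ᴴ * K k = 1) (hσ : σ.PosDef) (hτ : τ.PosDef)
    (hKσ : kraus K σ = τ) (hX : X.PosSemidef) (hY : Y.PosSemidef) (hα : α ≠ 0)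
    (hs : α * (1 + 2 * s) = 1) (hs0 : 0 < 2 * s) (hs1 : 2 * s < 1)
    (hYρ : Y = cpow hσ.posSemidef s * ρ * cpow hσ.posSemidef s)
    (hXρ : X = cpow hτ.posSemidef s * kraus K ρ * cpow hτ.posSemidef s)
    (hpos : 0 < tracePow hY α) (heq : tracePow hY α = tracePow hX α) (z : ℂ) :
    pairing K hσ.posSemidef hτ.posSemidef hX hY α z = (tracePow hY α : ℂ) := by
  have h1 := sq_tracePow_le hK hσ hτ hX hY hα hs hYρ hXρ
  rw [← heq, sq] at h1
  refine eq_const_of_three_lines (differentiable_pairing K _ _ hX hY α) hpos hs0 hs1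
    (bddAbove_pairing K _ _ hX hY α)
    (fun z hz => norm_pairing_le_left _ _ hX hY hK hα hz)
    (fun z hz => ?_) (le_of_mul_le_mul_left h1 hpos) z
  rw [heq]
  exact norm_pairing_le_right hσ.posSemidef hX hY hτ hKσ hα hz

/-- If the data processing inequality is saturated, then `interp` acts as a power of `Y` on the
range of `Y`. -/
lemma interp_mul_cpow_zero (hK : ∑ k, (K k)ᴴ * K k = 1) (hσ : σ.PosDef) (hτ : τ.PosDef)
    (hKσ : kraus K σ = τ) (hX : X.PosSemidef) (hY : Y.PosSemidef) (hα : α ≠ 0)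
    (hs : α * (1 + 2 * s) = 1) (hs0 : 0 < 2 * s) (hs1 : 2 * s < 1)
    (hYρ : Y = cpow hσ.posSemidef s * ρ * cpow hσ.posSemidef s)
    (hXρ : X = cpow hτ.posSemidef s * kraus K ρ * cpow hτ.posSemidef s)
    (hpos : 0 < tracePow hY α) (heq : tracePow hY α = tracePow hX α) (z : ℂ) :
    interp K hσ.posSemidef hτ.posSemidef hX α z * cpow hY 0 = cpow hY (α * z) := by
  have hG : Differentiable ℂ fun z : ℂ => cpow hY (α * z) :=
    (differentiable_cpow hY).comp (by fun_prop)
  refine congrFun (eq_of_eq_on_imaginary_axis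
    ((differentiable_interp K hσ.posSemidef hτ.posSemidef hX α).mul_const _) hG
    fun w hw => ?_) z
  have hc : ‖interp K hσ.posSemidef hτ.posSemidef hX α w * cpow hY (-(α * w))‖ ≤ 1 :=
    norm_mul_le_one (norm_interp_le _ _ hX α hK hw) (norm_cpow_le hY (by simp [hw]))
  have ht : (cpow hY α * (interp K hσ.posSemidef hτ.posSemidef hX α w *
      cpow hY (-(α * w)))).trace = (tracePow hY α : ℂ) := by
    rw [← pairing_eq hK hσ hτ hKσ hX hY hα hs hs0 hs1 hYρ hXρ hpos heq w, pairing,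
      ← mul_assoc, trace_mul_comm, ← mul_assoc, cpow_mul]
    congr 3
    ring
  have h := mul_cpow_eq_of_trace_eq hY hα hc ht (α * w)
  rwa [mul_assoc, cpow_mul, neg_add_cancel] at h

/-- Kraus operators of the Petz recovery map. -/
noncomputable def petz (K : ι → Matrix (Fin m) (Fin n) ℂ) (hσ : σ.PosSemidef)
    (hτ : τ.PosSemidef) : ι → Matrix (Fin n) (Fin m) ℂ :=
  fun k => cpow hσ (1 / 2) * (K k)ᴴ * cpow hτ (-(1 / 2))

lemma kraus_petz (hσ : σ.PosSemidef) (hτ : τ.PosSemidef) (Z : Matrix (Fin m) (Fin m) ℂ) :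
    kraus (petz K hσ hτ) Z = cpow hσ (1 / 2) * kraus (fun k => (K k)ᴴ)
      (cpow hτ (-(1 / 2)) * Z * cpow hτ (-(1 / 2))) * cpow hσ (1 / 2) := by
  have h1 : (cpow hσ (1 / 2))ᴴ = cpow hσ (1 / 2) := by simp [cpow_conjTranspose]
  have h2 : (cpow hτ (-(1 / 2)))ᴴ = cpow hτ (-(1 / 2)) := by simp [cpow_conjTranspose]
  unfold petz
  rw [kraus_comp, h1, h2]

lemma isQuantumChannel_petz (hσ : σ.PosSemidef) (hτ : τ.PosDef) (hKσ : kraus K σ = τ) :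
    IsQuantumChannel (kraus (petz K hσ hτ.posSemidef)) := by
  refine isQuantumChannel_kraus _ ?_
  have h1 : (cpow hσ (1 / 2))ᴴ = cpow hσ (1 / 2) := by simp [cpow_conjTranspose]
  have h2 : (cpow hτ.posSemidef (-(1 / 2)))ᴴ = cpow hτ.posSemidef (-(1 / 2)) := by
    simp [cpow_conjTranspose]
  have h3 : cpow hσ (1 / 2) * cpow hσ (1 / 2) = σ := by rw [cpow_mul, add_halves, cpow_one]
  have h4 : cpow hτ.posSemidef (-(1 / 2)) * kraus K σ * cpow hτ.posSemidef (-(1 / 2)) = 1 := by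
    rw [hKσ, cpow_neg_half_mul_mul hτ]
  rw [← h4, kraus_apply, Matrix.mul_sum, Matrix.sum_mul]
  refine Finset.sum_congr rfl fun k _ => ?_
  rw [← congrArg (K k * · * (K k)ᴴ) h3]
  simp only [petz, conjTranspose_mul, conjTranspose_conjTranspose, h1, h2, Matrix.mul_assoc]

lemma kraus_petz_self (hK : ∑ k, (K k)ᴴ * K k = 1) (hσ : σ.PosSemidef) (hτ : τ.PosDef) :
    kraus (petz K hσ hτ.posSemidef) τ = σ := by
  have hK1 : kraus (fun k => (K k)ᴴ) 1 = 1 := by simpa [kraus_apply] using hK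
  rw [kraus_petz, cpow_neg_half_mul_mul hτ, hK1, mul_one, cpow_mul, add_halves, cpow_one]

/-- A positive semidefinite matrix that agrees with `Y` on the range of `Y` dominates `Y`. -/
lemma posSemidef_sub_of_mul_cpow_zero {N : Matrix (Fin n) (Fin n) ℂ} (hN : N.PosSemidef)
    (hY : Y.PosSemidef) (h : N * cpow hY 0 = Y) : (N - Y).PosSemidef := by
  have he : (cpow hY 0)ᴴ = cpow hY 0 := by simp [cpow_conjTranspose]
  have h' : cpow hY 0 * N = Y := by
    have := congrArg conjTranspose h
    rwa [conjTranspose_mul, he, hN.1, hY.1] at this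
  have hYe : Y * cpow hY 0 = Y := by
    rw [← congrArg (· * cpow hY 0) (cpow_one hY), cpow_mul, add_zero, cpow_one]
  have hD := hN.mul_mul_conjTranspose_same (1 - cpow hY 0)
  have : (1 - cpow hY 0) * N * (1 - cpow hY 0)ᴴ = N - Y := by
    rw [conjTranspose_sub, conjTranspose_one, he, sub_mul, h', one_mul, mul_sub, mul_one, sub_mul,
      h, hYe, sub_self, sub_zero]
  rwa [this] at hD

/-- If the data processing inequality is saturated then the Petz map recovers the state. -/
lemma kraus_petz_kraus (hK : ∑ k, (K k)ᴴ * K k = 1) (hσ : σ.PosDef) (hτ : τ.PosDef)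
    (hρ : ρ.PosSemidef)
    (hKσ : kraus K σ = τ) (hX : X.PosSemidef) (hY : Y.PosSemidef) (hα : α ≠ 0)
    (hs : α * (1 + 2 * s) = 1) (hs0 : 0 < 2 * s) (hs1 : 2 * s < 1)
    (hYρ : Y = cpow hσ.posSemidef s * ρ * cpow hσ.posSemidef s)
    (hXρ : X = cpow hτ.posSemidef s * kraus K ρ * cpow hτ.posSemidef s)
    (hpos : 0 < tracePow hY α) (heq : tracePow hY α = tracePow hX α) :
    kraus (petz K hσ.posSemidef hτ.posSemidef) (kraus K ρ) = ρ := by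
  set R := kraus (petz K hσ.posSemidef hτ.posSemidef) (kraus K ρ)
  set S := cpow hσ.posSemidef s
  have hSh : Sᴴ = S := cpow_conjTranspose_ofReal _ _
  have hR : R.PosSemidef := kraus_posSemidef _ (kraus_posSemidef _ hρ)
  have hαc : (α : ℂ) ≠ 0 := by exact_mod_cast hα
  have hsc : (1 / α : ℂ) / 2 = 1 / 2 + s := by
    have : (α : ℂ) * (1 + 2 * s) = 1 := by exact_mod_cast hs
    field_simp
    linear_combination -this
  have hN : interp K hσ.posSemidef hτ.posSemidef hX α (1 / α) = S * R * S := by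
    have e1 : cpow hσ.posSemidef ((1 / α : ℂ) / 2) = S * cpow hσ.posSemidef (1 / 2) := by
      rw [hsc, cpow_mul, add_comm]
    have e2 : cpow hσ.posSemidef ((1 / α : ℂ) / 2) = cpow hσ.posSemidef (1 / 2) * S := by
      rw [hsc, cpow_mul]
    have e3 : cpow hτ.posSemidef (-((1 / α : ℂ) / 2)) * cpow hτ.posSemidef s =
        cpow hτ.posSemidef (-(1 / 2)) := by
      rw [hsc, cpow_mul]
      congr 1
      ring
    have e4 : cpow hτ.posSemidef s * cpow hτ.posSemidef (-((1 / α : ℂ) / 2)) =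
        cpow hτ.posSemidef (-(1 / 2)) := by
      rw [← e3, cpow_mul, cpow_mul, add_comm]
    have e5 : cpow hτ.posSemidef (-((1 / α : ℂ) / 2)) * X *
        cpow hτ.posSemidef (-((1 / α : ℂ) / 2)) =
        cpow hτ.posSemidef (-(1 / 2)) * kraus K ρ * cpow hτ.posSemidef (-(1 / 2)) := by
      rw [hXρ]
      simp only [mul_assoc]
      rw [e4]
      simp only [← mul_assoc]
      rw [e3]
    have e6 : cpow hX (α * (1 / α)) = X := by
      rw [mul_one_div_cancel hαc, cpow_one]
    rw [interp, e6, e5]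
    nth_rewrite 1 [e1]
    rw [e2]
    simp only [R]
    rw [kraus_petz]
    simp only [mul_assoc]
  have hNY : S * R * S * cpow hY 0 = Y := by
    rw [← hN, interp_mul_cpow_zero hK hσ hτ hKσ hX hY hα hs hs0 hs1 hYρ hXρ hpos heq,
      mul_one_div_cancel hαc, cpow_one]
  have hNp : (S * R * S).PosSemidef := by
    have := hR.mul_mul_conjTranspose_same S
    rwa [hSh] at this
  have hD := posSemidef_sub_of_mul_cpow_zero hNp hY hNY
  set S' := cpow hσ.posSemidef (-s)
  have hSh' : S'ᴴ = S' := by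
    simp [S', cpow_conjTranspose]
  have hD' := hD.mul_mul_conjTranspose_same S'
  have hRρ : S' * (S * R * S - Y) * S'ᴴ = R - ρ := by
    have h1 : S' * S = 1 := cpow_neg_mul_cpow hσ s
    have h2 : S * S' = 1 := cpow_mul_cpow_neg hσ s
    have (Z : Matrix (Fin n) (Fin n) ℂ) : S' * (S * Z * S) * S' = Z := by
      rw [mul_assoc, mul_assoc, h2, mul_one, ← mul_assoc, h1, one_mul]
    rw [hSh', mul_sub, sub_mul, hYρ, this, this]
  rw [hRρ] at hD'
  have htr : (R - ρ).trace = 0 := by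
    rw [trace_sub, (isQuantumChannel_petz hσ.posSemidef hτ hKσ).2,
      (isQuantumChannel_kraus K hK).2, sub_self]
  exact sub_eq_zero.1 (hD'.trace_eq_zero_iff.1 htr)

end Monotonicity

section SandwichedEntropy

variable {n : ℕ} {α : ℝ} {ψ φ : Matrix (Fin n) (Fin n) ℂ}

/-- The matrix whose `α`-th power has its trace taken in the sandwiched Rényi relative entropy. -/
noncomputable def sandwich (α : ℝ) (ψ : Matrix (Fin n) (Fin n) ℂ) (hφ : φ.PosSemidef) :
    Matrix (Fin n) (Fin n) ℂ :=
  cpow hφ ((1 - α) / (2 * α) : ℝ) * ψ * cpow hφ ((1 - α) / (2 * α) : ℝ)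

lemma sandwich_posSemidef (α : ℝ) (hψ : ψ.PosSemidef) (hφ : φ.PosSemidef) :
    (sandwich α ψ hφ).PosSemidef := by
  have := hψ.mul_mul_conjTranspose_same (cpow hφ ((1 - α) / (2 * α) : ℝ))
  rwa [cpow_conjTranspose_ofReal] at this

lemma sandwichedRenyi_eq (hα₀ : 0 < α) (hα₁ : α < 1) (hψ : ψ.PosSemidef) (hφ : φ.PosSemidef) :
    sandwichedRenyi α ψ φ =
      1 / (α - 1) * Real.log (tracePow (sandwich_posSemidef α hψ hφ) α) := by
  have hs : (1 - α) / (2 * α) ≠ 0 := (div_pos (by linarith) (by linarith)).ne'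
  rw [sandwichedRenyi, ← cpow_eq_mpow hφ hs]
  change _ * Real.log (mpow (sandwich α ψ hφ) α).trace.re = _
  rw [← cpow_eq_mpow (sandwich_posSemidef α hψ hφ) hα₀.ne', trace_cpow _ hα₀.ne',
    Complex.ofReal_re]

lemma tracePow_sandwich_pos (hψ : ψ.PosSemidef) (hψ1 : ψ.trace = 1) (hφ : φ.PosDef) :
    0 < tracePow (sandwich_posSemidef α hψ hφ.posSemidef) α := by
  refine tracePow_pos _ (fun h => ?_) α
  have h1 := congrArg (fun Z => cpow hφ.posSemidef (-((1 - α) / (2 * α) : ℝ)) * Z *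
    cpow hφ.posSemidef (-((1 - α) / (2 * α) : ℝ))) h
  simp only [sandwich, mul_zero, zero_mul] at h1
  rw [mul_assoc, mul_assoc, cpow_mul_cpow_neg hφ, mul_one, ← mul_assoc, cpow_neg_mul_cpow hφ,
    one_mul] at h1
  simp [h1] at hψ1

lemma one_le_of_trace_eq_one (hψ1 : ψ.trace = 1) : 1 ≤ n := by
  rcases Nat.eq_zero_or_pos n with rfl | h
  · simp [Matrix.trace] at hψ1
  · exact h

end SandwichedEntropy

end SandwichedRenyi

open SandwichedRenyi in
theorem equality_in_DPI_iff_sufficient {n m : ℕ}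
    (Φ : Matrix (Fin n) (Fin n) ℂ →ₗ[ℂ] Matrix (Fin m) (Fin m) ℂ)
    (hΦ : IsQuantumChannel Φ)
    (ψ φ : Matrix (Fin n) (Fin n) ℂ)
    (hψ : ψ.PosSemidef) (hψ1 : ψ.trace = 1) (hφ : φ.PosDef) (hΦφ : (Φ φ).PosDef)
    (α : ℝ) (hα₁ : 1 / 2 < α) (hα₂ : α < 1) :
    sandwichedRenyi α ψ φ = sandwichedRenyi α (Φ ψ) (Φ φ) ↔
      ∃ Ψ : Matrix (Fin m) (Fin m) ℂ →ₗ[ℂ] Matrix (Fin n) (Fin n) ℂ,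
        IsQuantumChannel Ψ ∧ Ψ (Φ ψ) = ψ ∧ Ψ (Φ φ) = φ := by
  have hα₀ : 0 < α := by linarith
  have hs : α * (1 + 2 * ((1 - α) / (2 * α))) = 1 := by field_simp; ring
  have hs0 : 0 < 2 * ((1 - α) / (2 * α)) := mul_pos two_pos (div_pos (by linarith) (by linarith))
  have hs1 : 2 * ((1 - α) / (2 * α)) < 1 := by nlinarith
  have hΦψ1 : (Φ ψ).trace = 1 := by rw [hΦ.2, hψ1]
  obtain ⟨K, rfl⟩ := exists_kraus (one_le_of_trace_eq_one hψ1) hΦ.1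
  have hK := sum_kraus_eq_one hΦ.2
  have hΦψ := kraus_posSemidef K hψ
  have hY := sandwich_posSemidef α hψ hφ.posSemidef
  have hX := sandwich_posSemidef α hΦψ hΦφ.posSemidef
  have hQ := tracePow_sandwich_pos (α := α) hψ hψ1 hφ
  have hQ' := tracePow_sandwich_pos (α := α) hΦψ hΦψ1 hΦφ
  rw [sandwichedRenyi_eq hα₀ hα₂ hψ hφ.posSemidef,
    sandwichedRenyi_eq hα₀ hα₂ hΦψ hΦφ.posSemidef,
    mul_right_inj' (one_div_ne_zero (sub_ne_zero.2 hα₂.ne)), Real.log_injOn_pos.eq_iff hQ hQ']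
  constructor
  · intro h
    exact ⟨kraus (petz K hφ.posSemidef hΦφ.posSemidef), isQuantumChannel_petz _ hΦφ rfl,
      kraus_petz_kraus hK hφ hΦφ hψ rfl hX hY hα₀.ne' hs hs0 hs1 rfl rfl hQ h,
      kraus_petz_self hK _ hΦφ⟩
  · rintro ⟨Ψ, hΨ, hΨψ, hΨφ⟩
    refine le_antisymm (tracePow_le hK hφ hΦφ rfl hX hY hα₀.ne' hs hs0 hs1 rfl rfl) ?_
    obtain ⟨L, rfl⟩ := exists_kraus (one_le_of_trace_eq_one hΦψ1) hΨ.1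
    refine tracePow_le (sum_kraus_eq_one hΨ.2) hΦφ hφ hΨφ hY hX hα₀.ne' hs hs0 hs1 rfl ?_
    rw [hΨψ]
    rfl
end

section
/- Let Φ : M_n(ℂ) → M_m(ℂ) be a quantum channel, let ψ be an n×n density matrix, let φ be a positive definite n×n complex matrix such that Φ(φ) is positive definite, and let α ∈ [1/2, 1) ∪ (1, ∞). Then the data processing inequality holds: D_α(Φ(ψ)‖Φ(φ)) ≤ D_α(ψ‖φ). -/
open Matrix
open scoped ComplexOrder

theorem parallel_sum_norm_sq_le {b t : ℝ} (hb : 0 ≤ b) (ht : 0 < t) (p q : ℂ) :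
    b * t / (t + b) * ‖p + q‖ ^ 2 ≤ b * ‖p‖ ^ 2 + t * ‖q‖ ^ 2 := by
  have h : ‖p + q‖ ^ 2 ≤ (‖p‖ + ‖q‖) ^ 2 := by gcongr; exact norm_add_le p q
  have hbt : 0 < t + b := by positivity
  calc b * t / (t + b) * ‖p + q‖ ^ 2 ≤ b * t / (t + b) * (‖p‖ + ‖q‖) ^ 2 := by gcongr
    _ ≤ b * ‖p‖ ^ 2 + t * ‖q‖ ^ 2 := by
      rw [div_mul_eq_mul_div, div_le_iff₀ hbt]
      nlinarith [sq_nonneg (b * ‖p‖ - t * ‖q‖)]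

theorem weighted_norm_sq_resolvent_le {ι ι' κ κ' : Type*} [Fintype ι] [Fintype ι'] [Fintype κ]
    [Fintype κ'] (T : Matrix ι ι' ℂ → Matrix κ κ' ℂ) (hT : ∀ x y, T (x + y) = T x + T y)
    (a : ι → ι' → ℝ) (b : κ → κ' → ℝ) (ha : ∀ i j, 0 ≤ a i j) (hb : ∀ i j, 0 ≤ b i j)
    (h0 : ∀ v, ∑ i, ∑ j, ‖T v i j‖ ^ 2 ≤ ∑ i, ∑ j, ‖v i j‖ ^ 2)
    (h1 : ∀ v, ∑ i, ∑ j, b i j * ‖T v i j‖ ^ 2 ≤ ∑ i, ∑ j, a i j * ‖v i j‖ ^ 2)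
    {t : ℝ} (ht : 0 < t) (v : Matrix ι ι' ℂ) :
    ∑ i, ∑ j, b i j * t / (t + b i j) * ‖T v i j‖ ^ 2 ≤
      ∑ i, ∑ j, a i j * t / (t + a i j) * ‖v i j‖ ^ 2 := by
  let x : Matrix ι ι' ℂ := of fun i j => ((t / (t + a i j) : ℝ) : ℂ) * v i j
  let y : Matrix ι ι' ℂ := of fun i j => ((a i j / (t + a i j) : ℝ) : ℂ) * v i j
  have hpos : ∀ i j, 0 < t + a i j := fun i j => by have := ha i j; positivity
  have hv : v = x + y := by
    ext i j
    have := (hpos i j).ne'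
    simp only [x, y, Matrix.add_apply, of_apply, ← add_mul, ← Complex.ofReal_add]
    rw [← add_div, div_self this]; simp
  calc ∑ i, ∑ j, b i j * t / (t + b i j) * ‖T v i j‖ ^ 2
      ≤ ∑ i, ∑ j, (b i j * ‖T x i j‖ ^ 2 + t * ‖T y i j‖ ^ 2) := by
        gcongr with i _ j _
        rw [hv, hT]
        exact parallel_sum_norm_sq_le (hb i j) ht _ _
    _ = (∑ i, ∑ j, b i j * ‖T x i j‖ ^ 2) + t * ∑ i, ∑ j, ‖T y i j‖ ^ 2 := by
        simp only [Finset.sum_add_distrib, Finset.mul_sum]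
    _ ≤ (∑ i, ∑ j, a i j * ‖x i j‖ ^ 2) + t * ∑ i, ∑ j, ‖y i j‖ ^ 2 := by
        gcongr
        exacts [h1 x, h0 y]
    _ = ∑ i, ∑ j, a i j * t / (t + a i j) * ‖v i j‖ ^ 2 := by
        simp only [Finset.mul_sum, ← Finset.sum_add_distrib]
        refine Finset.sum_congr rfl fun i _ => Finset.sum_congr rfl fun j _ => ?_
        have := (hpos i j).ne'
        simp only [x, y, of_apply, norm_mul, Complex.norm_real, mul_pow, Real.norm_eq_abs, sq_abs]
        field_simp

open MeasureTheory Set in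
theorem weighted_norm_sq_rpow_eq_integral {ι ι' : Type*} [Fintype ι] [Fintype ι'] {r : ℝ}
    {μ : Measure ℝ} (hμ : ∀ x ∈ Ici (0 : ℝ),
      IntegrableOn (fun t => Real.rpowIntegrand₀₁ r t x) (Ioi 0) μ ∧
        x ^ r = ∫ t in Ioi 0, Real.rpowIntegrand₀₁ r t x ∂μ)
    (c : ι → ι' → ℝ) (w : Matrix ι ι' ℂ) (hc : ∀ i j, 0 ≤ c i j) :
    IntegrableOn (fun t => ∑ i, ∑ j, Real.rpowIntegrand₀₁ r t (c i j) * ‖w i j‖ ^ 2) (Ioi 0) μ ∧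
      ∑ i, ∑ j, c i j ^ r * ‖w i j‖ ^ 2 =
        ∫ t in Ioi 0, ∑ i, ∑ j, Real.rpowIntegrand₀₁ r t (c i j) * ‖w i j‖ ^ 2 ∂μ := by
  have hint : ∀ i j, IntegrableOn
      (fun t => Real.rpowIntegrand₀₁ r t (c i j) * ‖w i j‖ ^ 2) (Ioi 0) μ :=
    fun i j => (hμ _ (hc i j)).1.mul_const _
  refine ⟨integrable_finsetSum _ fun i _ => integrable_finsetSum _ fun j _ => hint i j, ?_⟩
  rw [integral_finsetSum _ fun i _ => integrable_finsetSum _ fun j _ => hint i j]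
  refine Finset.sum_congr rfl fun i _ => ?_
  rw [integral_finsetSum _ fun j _ => hint i j]
  refine Finset.sum_congr rfl fun j _ => ?_
  rw [integral_mul_const, ← (hμ _ (hc i j)).2]

theorem weighted_norm_sq_rpowIntegrand {ι ι' : Type*} [Fintype ι] [Fintype ι'] {r t : ℝ}
    (hr : r ∈ Set.Ioo 0 1) (ht : 0 < t)
    (c : ι → ι' → ℝ) (w : Matrix ι ι' ℂ) (hc : ∀ i j, 0 ≤ c i j) :
    ∑ i, ∑ j, Real.rpowIntegrand₀₁ r t (c i j) * ‖w i j‖ ^ 2 =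
      t ^ (r - 1) / t * ∑ i, ∑ j, c i j * t / (t + c i j) * ‖w i j‖ ^ 2 := by
  simp only [Finset.mul_sum]
  refine Finset.sum_congr rfl fun i _ => Finset.sum_congr rfl fun j _ => ?_
  rw [Real.rpowIntegrand₀₁_eq_pow_div hr ht.le (hc i j)]
  field_simp

/-- Quadratic interpolation between two weighted `ℓ²` contraction estimates. -/
theorem weighted_norm_sq_rpow_le {ι ι' κ κ' : Type*} [Fintype ι] [Fintype ι'] [Fintype κ]
    [Fintype κ'] (T : Matrix ι ι' ℂ → Matrix κ κ' ℂ) (hT : ∀ x y, T (x + y) = T x + T y)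
    (a : ι → ι' → ℝ) (b : κ → κ' → ℝ) (ha : ∀ i j, 0 ≤ a i j) (hb : ∀ i j, 0 ≤ b i j)
    (h0 : ∀ v, ∑ i, ∑ j, ‖T v i j‖ ^ 2 ≤ ∑ i, ∑ j, ‖v i j‖ ^ 2)
    (h1 : ∀ v, ∑ i, ∑ j, b i j * ‖T v i j‖ ^ 2 ≤ ∑ i, ∑ j, a i j * ‖v i j‖ ^ 2)
    {r : ℝ} (hr0 : 0 < r) (hr1 : r ≤ 1) (v : Matrix ι ι' ℂ) :
    ∑ i, ∑ j, b i j ^ r * ‖T v i j‖ ^ 2 ≤ ∑ i, ∑ j, a i j ^ r * ‖v i j‖ ^ 2 := by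
  rcases hr1.eq_or_lt with rfl | hr1
  · simpa using h1 v
  have hr : r ∈ Set.Ioo 0 1 := ⟨hr0, hr1⟩
  obtain ⟨μ, hμ⟩ := Real.exists_measure_rpow_eq_integral_rpowIntegrand₀₁ hr
  obtain ⟨ib, eb⟩ := weighted_norm_sq_rpow_eq_integral hμ b (T v) hb
  obtain ⟨ia, ea⟩ := weighted_norm_sq_rpow_eq_integral hμ a v ha
  rw [eb, ea]
  refine MeasureTheory.setIntegral_mono_on ib ia measurableSet_Ioi fun t ht => ?_
  have ht : 0 < t := ht
  rw [weighted_norm_sq_rpowIntegrand hr ht b (T v) hb, weighted_norm_sq_rpowIntegrand hr ht a v ha]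
  gcongr t ^ (r - 1) / t * ?_
  exact weighted_norm_sq_resolvent_le T hT a b ha hb h0 h1 ht v

open scoped Kronecker

section MatrixEstimates

variable {ι κ m n ρ : Type*} [Fintype ι] [Fintype κ] [Fintype m] [Fintype n] [Fintype ρ]
  [DecidableEq ι] [DecidableEq κ] [DecidableEq m] [DecidableEq n] [DecidableEq ρ]

/-- The `r`-th power of the matrix with eigenbasis `U` and eigenvalues `f`. -/
noncomputable def spectralPow (U : Matrix ι ι ℂ) (f : ι → ℝ) (r : ℝ) : Matrix ι ι ℂ :=
  U * diagonal (fun i => ((f i ^ r : ℝ) : ℂ)) * Uᴴ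

theorem spectralPow_mul {U : Matrix ι ι ℂ} (hU : Uᴴ * U = 1) {f : ι → ℝ} (hf : ∀ i, 0 < f i)
    (r s : ℝ) : spectralPow U f r * spectralPow U f s = spectralPow U f (r + s) := by
  have : diagonal (fun i => ((f i ^ r : ℝ) : ℂ)) * diagonal (fun i => ((f i ^ s : ℝ) : ℂ)) =
      diagonal (fun i => ((f i ^ (r + s) : ℝ) : ℂ)) := by
    rw [diagonal_mul_diagonal]
    congr 1
    ext i
    rw [Real.rpow_add (hf i), Complex.ofReal_mul]
  rw [spectralPow, spectralPow, spectralPow, ← this]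
  simp only [Matrix.mul_assoc]
  rw [← Matrix.mul_assoc Uᴴ U, hU, Matrix.one_mul]

theorem spectralPow_zero {U : Matrix ι ι ℂ} (hU : Uᴴ * U = 1) (f : ι → ℝ) :
    spectralPow U f 0 = 1 := by
  simp [spectralPow, mul_eq_one_comm.mp hU]

theorem conjTranspose_spectralPow (U : Matrix ι ι ℂ) (f : ι → ℝ) (r : ℝ) :
    (spectralPow U f r)ᴴ = spectralPow U f r := by
  simp only [spectralPow, conjTranspose_mul, conjTranspose_conjTranspose, diagonal_conjTranspose,
    Matrix.mul_assoc]
  congr 3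
  ext i
  simp

omit [Fintype κ] [DecidableEq ι] [DecidableEq κ] in
theorem conjTranspose_mul_self_apply_eq_sum_norm_sq (M : Matrix ι κ ℂ) (j : κ) :
    (Mᴴ * M) j j = ((∑ i, ‖M i j‖ ^ 2 : ℝ) : ℂ) := by
  simp [mul_apply, Complex.conj_mul']

theorem trace_diagonal_mul_mul_diagonal_mul (M : Matrix ι κ ℂ) (w : ι → ℝ) (u : κ → ℝ) :
    (diagonal (fun i => (w i : ℂ)) * M * diagonal (fun j => (u j : ℂ)) * Mᴴ).trace =
      ((∑ i, ∑ j, w i * u j * ‖M i j‖ ^ 2 : ℝ) : ℂ) := by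
  simp only [trace, diag_apply, mul_apply (N := Mᴴ), mul_diagonal, diagonal_mul,
    conjTranspose_apply, Complex.ofReal_sum, Complex.ofReal_mul, Complex.ofReal_pow]
  refine Finset.sum_congr rfl fun i _ => Finset.sum_congr rfl fun j _ => ?_
  rw [← Complex.mul_conj']
  simp only [RCLike.star_def]
  ring

theorem sum_norm_sq_unitary_mul_mul {U : Matrix ι ι ℂ} {R : Matrix κ κ ℂ} (w : ι → ℝ) (u : κ → ℝ)
    (M : Matrix ι κ ℂ) :
    ((∑ i, ∑ j, w i * u j * ‖(Uᴴ * M * R) i j‖ ^ 2 : ℝ) : ℂ) =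
      ((U * diagonal (fun i => (w i : ℂ)) * Uᴴ) * M *
        (R * diagonal (fun j => (u j : ℂ)) * Rᴴ) * Mᴴ).trace := by
  rw [← trace_diagonal_mul_mul_diagonal_mul]
  simp only [conjTranspose_mul, conjTranspose_conjTranspose, Matrix.mul_assoc]
  rw [trace_mul_comm U]
  simp only [Matrix.mul_assoc]

/-- Partial trace over the first tensor factor. -/
def partialTraceLeft (σ : Matrix (ρ × n) (ρ × n) ℂ) : Matrix n n ℂ :=
  ∑ x, σ.submatrix (fun i => (x, i)) (fun i => (x, i))

omit [DecidableEq n] in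
theorem trace_one_kronecker_mul (A : Matrix n n ℂ) (σ : Matrix (ρ × n) (ρ × n) ℂ) :
    (((1 : Matrix ρ ρ ℂ) ⊗ₖ A) * σ).trace = (A * partialTraceLeft σ).trace := by
  simp only [trace, diag_apply, mul_apply, partialTraceLeft, kroneckerMap_apply, one_apply,
    Fintype.sum_prod_type, Matrix.sum_apply, submatrix_apply, Finset.mul_sum, ite_mul, one_mul,
    zero_mul, Finset.sum_ite_irrel, Finset.sum_const_zero, Finset.sum_ite_eq, Finset.mem_univ,
    if_true]
  rw [Finset.sum_comm]

theorem trace_partialTraceLeft (σ : Matrix (ρ × n) (ρ × n) ℂ) :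
    (partialTraceLeft σ).trace = σ.trace := by
  simpa using (trace_one_kronecker_mul (1 : Matrix n n ℂ) σ).symm

omit [Fintype n] [DecidableEq n] [DecidableEq ρ] in
theorem posSemidef_partialTraceLeft {σ : Matrix (ρ × n) (ρ × n) ℂ} (hσ : σ.PosSemidef) :
    (partialTraceLeft σ).PosSemidef :=
  posSemidef_sum _ fun _ _ => hσ.submatrix _

theorem posSemidef_mul_diagonal_mul_conjTranspose (R : Matrix κ κ ℂ) {g : κ → ℝ}
    (hg : ∀ k, 0 ≤ g k) : (R * diagonal (fun k => (g k : ℂ)) * Rᴴ).PosSemidef :=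
  (PosSemidef.diagonal fun k => by simpa using hg k).mul_mul_conjTranspose_same R

open scoped MatrixOrder in
theorem Matrix.PosSemidef.exists_eq_conjTranspose_mul_self {A : Matrix ι ι ℂ} (hA : A.PosSemidef) :
    ∃ B : Matrix ι ι ℂ, A = Bᴴ * B :=
  CStarAlgebra.nonneg_iff_eq_star_mul_self.mp hA.nonneg

theorem re_trace_mul_nonneg {A B : Matrix ι ι ℂ} (hA : A.PosSemidef) (hB : B.PosSemidef) :
    0 ≤ (A * B).trace.re := by
  obtain ⟨C, rfl⟩ := hB.exists_eq_conjTranspose_mul_self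
  rw [← Matrix.mul_assoc, trace_mul_comm, ← Matrix.mul_assoc]
  exact (Complex.le_def.mp (hA.mul_mul_conjTranspose_same C).trace_nonneg).1

/-- Operator convexity of the inverse: `Kᴴ (K D Kᴴ)⁻¹ K ≤ D⁻¹`. -/
theorem posSemidef_inv_sub_conjTranspose_mul_inv_mul {K : Matrix m κ ℂ} {D D' : Matrix κ κ ℂ}
    {P : Matrix m m ℂ} (hD : D.PosSemidef) (hDD' : D' * D = 1) (hD' : D'ᴴ = D')
    (hPh : Pᴴ = P) (hP : P * (K * D * Kᴴ) = 1) :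
    (D' - Kᴴ * P * K).PosSemidef := by
  have hDD : D * D' = 1 := mul_eq_one_comm.mp hDD'
  have h := hD.conjTranspose_mul_mul_same (D' - Kᴴ * P * K)
  have e : (D' - Kᴴ * P * K)ᴴ * D * (D' - Kᴴ * P * K) = D' - Kᴴ * P * K := by
    simp only [conjTranspose_sub, conjTranspose_mul, conjTranspose_conjTranspose, hD', hPh]
    calc _ = D' * D * D' - D' * D * (Kᴴ * P * K) - Kᴴ * P * K * (D * D') +
          Kᴴ * (P * (K * D * Kᴴ)) * (P * K) := by
          simp only [Matrix.sub_mul, Matrix.mul_sub, Matrix.mul_assoc]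
          abel
      _ = _ := by
          rw [hDD', hDD, hP]
          simp only [Matrix.one_mul, Matrix.mul_one, Matrix.mul_assoc]
          abel
  rwa [e] at h

theorem rpow_weighted_norm_sq_channel_le {K : Matrix m (ρ × n) ℂ}
    (hK : ∀ X : Matrix n n ℂ, (K * ((1 : Matrix ρ ρ ℂ) ⊗ₖ X) * Kᴴ).trace = X.trace)
    {U : Matrix n n ℂ} (hU : Uᴴ * U = 1) {f : n → ℝ} (hf : ∀ i, 0 < f i)
    {V : Matrix m m ℂ} (hV : Vᴴ * V = 1) {h : m → ℝ} (hh : ∀ i, 0 < h i)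
    (hout : spectralPow V h 1 = K * ((1 : Matrix ρ ρ ℂ) ⊗ₖ spectralPow U f 1) * Kᴴ)
    {R : Matrix (ρ × n) (ρ × n) ℂ} (hR : Rᴴ * R = 1) {g : ρ × n → ℝ} (hg : ∀ k, 0 ≤ g k)
    {S : Matrix n n ℂ} (hS : Sᴴ * S = 1) {g' : n → ℝ} (hg' : ∀ k, 0 ≤ g' k)
    (hσ : partialTraceLeft (R * diagonal (fun k => (g k : ℂ)) * Rᴴ) =
      S * diagonal (fun k => (g' k : ℂ)) * Sᴴ)
    {r : ℝ} (hr0 : 0 < r) (hr1 : r ≤ 1) (Y : Matrix n n ℂ) :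
    ∑ i, ∑ j, (g j / h i) ^ r * ‖(Vᴴ * (K * ((1 : Matrix ρ ρ ℂ) ⊗ₖ Y)) * R) i j‖ ^ 2 ≤
      ∑ i, ∑ j, (g' j / f i) ^ r * ‖(Uᴴ * Y * S) i j‖ ^ 2 := by
  have hRR := mul_eq_one_comm.mp hR
  have hSS := mul_eq_one_comm.mp hS
  have hUU := mul_eq_one_comm.mp hU
  have hVV := mul_eq_one_comm.mp hV
  have hsubst : ∀ M : Matrix n n ℂ, Uᴴ * (U * M * Sᴴ) * S = M := fun M => by
    calc _ = (Uᴴ * U) * M * (Sᴴ * S) := by simp only [Matrix.mul_assoc]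
      _ = M := by rw [hU, hS, Matrix.one_mul, Matrix.mul_one]
  have hsubst' : U * (Uᴴ * Y * S) * Sᴴ = Y := by
    calc _ = (U * Uᴴ) * Y * (S * Sᴴ) := by simp only [Matrix.mul_assoc]
      _ = Y := by rw [hUU, hSS, Matrix.one_mul, Matrix.mul_one]
  let T : Matrix n n ℂ → Matrix m (ρ × n) ℂ := fun M =>
    Vᴴ * (K * ((1 : Matrix ρ ρ ℂ) ⊗ₖ (U * M * Sᴴ))) * R
  have hT : ∀ x y, T (x + y) = T x + T y := fun x y => by
    simp only [T, Matrix.mul_add, Matrix.add_mul, kronecker_add]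
  have hres := weighted_norm_sq_rpow_le T hT (fun i j => g' j / f i) (fun i j => g j / h i)
    (fun i j => div_nonneg (hg' j) (hf i).le) (fun i j => div_nonneg (hg j) (hh i).le)
    ?_ ?_ hr0 hr1 (Uᴴ * Y * S)
  · simpa only [T, hsubst'] using hres
  · intro M
    refine le_of_eq ?_
    have e1 := sum_norm_sq_unitary_mul_mul (U := V) (R := R) 1 1
      (K * ((1 : Matrix ρ ρ ℂ) ⊗ₖ (U * M * Sᴴ)))
    have e2 := sum_norm_sq_unitary_mul_mul (U := U) (R := S) 1 1 (U * M * Sᴴ)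
    simp only [Pi.one_apply, one_mul, Complex.ofReal_one, diagonal_one, Matrix.mul_one, hVV, hRR,
      hUU, hSS, Matrix.one_mul, hsubst] at e1 e2
    rw [← Complex.ofReal_inj, e1, e2, ← hK, conjTranspose_mul, conjTranspose_kronecker,
      conjTranspose_one, Matrix.mul_assoc K, ← Matrix.mul_assoc (_ ⊗ₖ _), ← mul_kronecker_mul,
      Matrix.one_mul, ← Matrix.mul_assoc]
  · intro M
    set N := U * M * Sᴴ with hN
    have e1 := sum_norm_sq_unitary_mul_mul (U := V) (R := R) (fun i => h i ^ (-1 : ℝ)) g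
      (K * ((1 : Matrix ρ ρ ℂ) ⊗ₖ N))
    have e2 := sum_norm_sq_unitary_mul_mul (U := U) (R := S) (fun i => f i ^ (-1 : ℝ)) g' N
    rw [← hσ] at e2
    rw [hN, hsubst, ← hN] at e2
    simp only [Real.rpow_neg_one, T] at e1 e2 ⊢
    have hps : (((1 : Matrix ρ ρ ℂ) ⊗ₖ spectralPow U f (-1)) -
        Kᴴ * spectralPow V h (-1) * K).PosSemidef := by
      refine posSemidef_inv_sub_conjTranspose_mul_inv_mul
        (D := (1 : Matrix ρ ρ ℂ) ⊗ₖ spectralPow U f 1) ?_ ?_ ?_ ?_ ?_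
      · refine PosSemidef.one.kronecker ?_
        exact posSemidef_mul_diagonal_mul_conjTranspose U fun i => by simpa using (hf i).le
      · rw [← mul_kronecker_mul, spectralPow_mul hU hf]
        simp [spectralPow_zero hU]
      · rw [conjTranspose_kronecker, conjTranspose_spectralPow, conjTranspose_one]
      · exact conjTranspose_spectralPow _ _ _
      · rw [← hout, spectralPow_mul hV hh]
        simp [spectralPow_zero hV]
    have hnn := re_trace_mul_nonneg
      (hps.conjTranspose_mul_mul_same ((1 : Matrix ρ ρ ℂ) ⊗ₖ N))
      (posSemidef_mul_diagonal_mul_conjTranspose R hg)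
    rw [Matrix.mul_sub, Matrix.sub_mul, Matrix.sub_mul, trace_sub, Complex.sub_re, sub_nonneg,
      conjTranspose_kronecker, conjTranspose_one, ← mul_kronecker_mul, ← mul_kronecker_mul,
      Matrix.one_mul, Matrix.one_mul, trace_one_kronecker_mul] at hnn
    have e1' := congrArg Complex.re e1
    have e2' := congrArg Complex.re e2
    rw [Complex.ofReal_re] at e1' e2'
    simp only [div_eq_inv_mul]
    rw [e1', e2']
    refine le_trans (le_of_eq ?_) (hnn.trans (le_of_eq ?_))
    · simp only [spectralPow, Real.rpow_neg_one]
      rw [conjTranspose_mul, conjTranspose_kronecker, conjTranspose_one, trace_mul_comm]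
      simp only [Matrix.mul_assoc]
    · simp only [spectralPow, Real.rpow_neg_one]
      rw [trace_mul_comm _ Nᴴ]
      simp only [Matrix.mul_assoc]

omit [Fintype κ] [DecidableEq κ] in
theorem sum_norm_sq_unitary_mul {U : Matrix ι ι ℂ} (hU : U * Uᴴ = 1) (M : Matrix ι κ ℂ) (j : κ) :
    ∑ i, ‖(Uᴴ * M) i j‖ ^ 2 = ∑ i, ‖M i j‖ ^ 2 := by
  rw [← Complex.ofReal_inj, ← conjTranspose_mul_self_apply_eq_sum_norm_sq,
    ← conjTranspose_mul_self_apply_eq_sum_norm_sq, conjTranspose_mul, conjTranspose_conjTranspose,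
    Matrix.mul_assoc, ← Matrix.mul_assoc U, hU, Matrix.one_mul]

omit [DecidableEq ι] in
theorem sum_norm_sq_mul_eq {Z : Matrix ι κ ℂ} {R : Matrix κ κ ℂ} {d : κ → ℝ}
    (hZ : Zᴴ * Z = R * diagonal (fun k => (d k : ℂ)) * Rᴴ) (S : Matrix κ κ ℂ) (j : κ) :
    ∑ i, ‖(Z * S) i j‖ ^ 2 = ∑ l, d l * ‖(Rᴴ * S) l j‖ ^ 2 := by
  have e : (Z * S)ᴴ * (Z * S) = (Rᴴ * S)ᴴ * (diagonal (fun k => (d k : ℂ)) * (Rᴴ * S)) := by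
    calc _ = Sᴴ * (Zᴴ * Z) * S := by simp only [conjTranspose_mul, Matrix.mul_assoc]
      _ = _ := by
        simp only [hZ, conjTranspose_mul, conjTranspose_conjTranspose, Matrix.mul_assoc]
  rw [← Complex.ofReal_inj, ← conjTranspose_mul_self_apply_eq_sum_norm_sq, e, mul_apply]
  simp only [diagonal_mul, conjTranspose_apply, Complex.ofReal_sum, Complex.ofReal_mul,
    Complex.ofReal_pow]
  refine Finset.sum_congr rfl fun l _ => ?_
  rw [← Complex.mul_conj']
  simp only [RCLike.star_def]
  ring

omit [DecidableEq ι] in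
theorem sum_norm_sq_mul_eigenbasis {Z : Matrix ι κ ℂ} {R : Matrix κ κ ℂ} {d : κ → ℝ}
    (hR : Rᴴ * R = 1) (hZ : Zᴴ * Z = R * diagonal (fun k => (d k : ℂ)) * Rᴴ) (j : κ) :
    ∑ i, ‖(Z * R) i j‖ ^ 2 = d j := by
  rw [sum_norm_sq_mul_eq hZ, hR]
  simp [one_apply, apply_ite norm, ite_pow]

/-- Hölder's inequality for two positive semidefinite matrices, in terms of their eigenvalues and
the overlap matrix `O` of their eigenbases. -/
theorem sum_rpow_mul_norm_sq_le {O : Matrix ι ι ℂ} (hO : Oᴴ * O = 1) {c g d : ι → ℝ} {r : ℝ}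
    (hr0 : 0 < r) (hr1 : r ≤ 1) (hc : ∀ i, 0 ≤ c i) (hg : ∀ i, 0 ≤ g i)
    (hd : ∀ i, d i ≤ c i ^ (1 - r)) (hC : 0 < ∑ i, c i) (hG : 0 < ∑ i, g i) :
    ∑ j, g j ^ r * ∑ l, d l * ‖O l j‖ ^ 2 ≤ (∑ i, c i) ^ (1 - r) * (∑ i, g i) ^ r := by
  set C := ∑ i, c i with hCdef
  set G := ∑ i, g i with hGdef
  have hcol : ∀ j, ∑ l, ‖O l j‖ ^ 2 = 1 := fun j => by
    rw [← Complex.ofReal_inj, ← conjTranspose_mul_self_apply_eq_sum_norm_sq, hO]; simp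
  have hrow : ∀ l, ∑ j, ‖O l j‖ ^ 2 = 1 := fun l => by
    have := conjTranspose_mul_self_apply_eq_sum_norm_sq Oᴴ l
    rw [conjTranspose_conjTranspose, mul_eq_one_comm.mp hO, one_apply_eq] at this
    simpa using (Complex.ofReal_inj.mp (by simpa using this)).symm
  have hterm : ∀ l j, c l ^ (1 - r) * g j ^ r ≤
      C ^ (1 - r) * G ^ r * ((1 - r) * (c l / C) + r * (g j / G)) := fun l j => by
    have h := Real.geom_mean_le_arith_mean2_weighted (sub_nonneg.mpr hr1) hr0.le
      (div_nonneg (hc l) hC.le) (div_nonneg (hg j) hG.le) (by ring)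
    calc c l ^ (1 - r) * g j ^ r
        = C ^ (1 - r) * G ^ r * ((c l / C) ^ (1 - r) * (g j / G) ^ r) := by
          rw [Real.div_rpow (hc l) hC.le, Real.div_rpow (hg j) hG.le]
          have := (Real.rpow_pos_of_pos hC (1 - r)).ne'
          have := (Real.rpow_pos_of_pos hG r).ne'
          field_simp
      _ ≤ _ := by gcongr
  calc ∑ j, g j ^ r * ∑ l, d l * ‖O l j‖ ^ 2
      ≤ ∑ j, ∑ l, C ^ (1 - r) * G ^ r * ((1 - r) * (c l / C) + r * (g j / G)) * ‖O l j‖ ^ 2 := by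
        gcongr with j _
        rw [Finset.mul_sum]
        refine Finset.sum_le_sum fun l _ => ?_
        rw [← mul_assoc]
        refine mul_le_mul_of_nonneg_right ?_ (sq_nonneg _)
        refine le_trans ?_ (hterm l j)
        rw [mul_comm]
        exact mul_le_mul_of_nonneg_right (hd l) (Real.rpow_nonneg (hg j) r)
    _ = C ^ (1 - r) * G ^ r * ((1 - r) * ((∑ l, c l * ∑ j, ‖O l j‖ ^ 2) / C) +
          r * ((∑ j, g j * ∑ l, ‖O l j‖ ^ 2) / G)) := by
        have e : ∑ l, c l * ∑ j, ‖O l j‖ ^ 2 = ∑ j, ∑ l, c l * ‖O l j‖ ^ 2 := by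
          simp only [Finset.mul_sum]
          exact Finset.sum_comm
        rw [e]
        simp only [Finset.mul_sum, Finset.sum_div, ← Finset.sum_add_distrib]
        refine Finset.sum_congr rfl fun j _ => Finset.sum_congr rfl fun l _ => ?_
        ring
    _ = C ^ (1 - r) * G ^ r := by
        simp only [hcol, hrow, mul_one, ← hCdef, ← hGdef, div_self hC.ne', div_self hG.ne']
        ring

theorem Matrix.PosSemidef.exists_spectral {A : Matrix ι ι ℂ} (hA : A.PosSemidef) :
    ∃ (U : Matrix ι ι ℂ) (e : ι → ℝ), Uᴴ * U = 1 ∧ (∀ i, 0 ≤ e i) ∧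
      A = U * diagonal (fun i => (e i : ℂ)) * Uᴴ := by
  refine ⟨hA.1.eigenvectorUnitary, hA.1.eigenvalues, ?_, hA.eigenvalues_nonneg, ?_⟩
  · exact Unitary.coe_star_mul_self hA.1.eigenvectorUnitary
  · conv_lhs => rw [hA.1.spectral_theorem, Unitary.conjStarAlgAut_apply]
    rfl

omit [Fintype κ] [DecidableEq κ] in
theorem spectralPow_mul_apply {U : Matrix ι ι ℂ} (hU : Uᴴ * U = 1) (f : ι → ℝ) (r : ℝ)
    (M : Matrix ι κ ℂ) (i : ι) (j : κ) :
    (Uᴴ * (spectralPow U f r * M)) i j = ((f i ^ r : ℝ) : ℂ) * (Uᴴ * M) i j := by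
  rw [spectralPow]
  simp only [Matrix.mul_assoc]
  rw [← Matrix.mul_assoc Uᴴ U, hU, Matrix.one_mul, diagonal_mul]

/-- Contractivity between noncommutative `L^p` spaces of the map induced by a channel in
Stinespring form. -/
theorem sum_rpow_mul_norm_sq_channel_le {K : Matrix m (ρ × n) ℂ}
    (hK : ∀ X : Matrix n n ℂ, (K * ((1 : Matrix ρ ρ ℂ) ⊗ₖ X) * Kᴴ).trace = X.trace)
    {U : Matrix n n ℂ} (hU : Uᴴ * U = 1) {f : n → ℝ} (hf : ∀ i, 0 < f i)
    {V : Matrix m m ℂ} (hV : Vᴴ * V = 1) {h : m → ℝ} (hh : ∀ i, 0 < h i)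
    (hout : spectralPow V h 1 = K * ((1 : Matrix ρ ρ ℂ) ⊗ₖ spectralPow U f 1) * Kᴴ)
    {R : Matrix (ρ × n) (ρ × n) ℂ} (hR : Rᴴ * R = 1) {g : ρ × n → ℝ} (hg : ∀ k, 0 ≤ g k)
    {Q : Matrix n n ℂ} (hQ : Qᴴ * Q = 1) {c d : n → ℝ} (hc : ∀ i, 0 ≤ c i)
    {r : ℝ} (hr0 : 0 < r) (hr1 : r ≤ 1) (hd : ∀ i, d i ≤ c i ^ (1 - r))
    (hC : 0 < ∑ i, c i) (hG : 0 < ∑ i, g i)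
    {Z : Matrix n n ℂ} (hZ : Zᴴ * Z = Q * diagonal (fun k => (d k : ℂ)) * Qᴴ) :
    ∑ k, g k ^ r * ∑ i, ‖(spectralPow V h (-(r / 2)) *
        (K * ((1 : Matrix ρ ρ ℂ) ⊗ₖ (spectralPow U f (r / 2) * Z))) * R) i k‖ ^ 2 ≤
      (∑ i, c i) ^ (1 - r) * (∑ i, g i) ^ r := by
  obtain ⟨S, g', hS, hg', hσ⟩ := (posSemidef_partialTraceLeft
    (posSemidef_mul_diagonal_mul_conjTranspose R hg)).exists_spectral
  have htr : ∑ i, g i = ∑ i, g' i := by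
    have h1 := trace_partialTraceLeft (R * diagonal (fun k => (g k : ℂ)) * Rᴴ)
    rw [hσ, trace_mul_comm, ← Matrix.mul_assoc, hS, Matrix.one_mul, trace_mul_comm _ Rᴴ,
      ← Matrix.mul_assoc, hR, Matrix.one_mul, trace_diagonal, trace_diagonal] at h1
    exact_mod_cast h1.symm
  have hmain := rpow_weighted_norm_sq_channel_le hK hU hf hV hh hout hR hg hS hg' hσ hr0 hr1
    (spectralPow U f (r / 2) * Z)
  have hholder := sum_rpow_mul_norm_sq_le (O := Qᴴ * S) (by
    rw [conjTranspose_mul, conjTranspose_conjTranspose, Matrix.mul_assoc, ← Matrix.mul_assoc Q,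
      mul_eq_one_comm.mp hQ, Matrix.one_mul, hS]) hr0 hr1 hc hg' hd hC (htr ▸ hG)
  rw [htr]
  refine le_trans (le_of_eq ?_) (hmain.trans (le_trans (le_of_eq ?_) hholder))
  · rw [Finset.sum_comm]
    refine Finset.sum_congr rfl fun k _ => ?_
    rw [← sum_norm_sq_unitary_mul (mul_eq_one_comm.mp hV), Finset.mul_sum]
    refine Finset.sum_congr rfl fun i _ => ?_
    rw [Matrix.mul_assoc (spectralPow V h _), spectralPow_mul_apply hV, norm_mul, mul_pow,
      Complex.norm_real, Real.norm_eq_abs, sq_abs, ← Real.rpow_mul_natCast (hh i).le,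
      Real.div_rpow (hg k) (hh i).le, Matrix.mul_assoc Vᴴ]
    have : -(r / 2) * (2 : ℕ) = -r := by push_cast; ring
    rw [this, Real.rpow_neg (hh i).le]
    ring
  · rw [Finset.sum_comm]
    refine Finset.sum_congr rfl fun j _ => ?_
    rw [← sum_norm_sq_mul_eq hZ, ← sum_norm_sq_unitary_mul (mul_eq_one_comm.mp hU),
      Finset.mul_sum]
    refine Finset.sum_congr rfl fun i _ => ?_
    rw [Matrix.mul_assoc Uᴴ, Matrix.mul_assoc (spectralPow U f _), spectralPow_mul_apply hU,
      norm_mul, mul_pow, Complex.norm_real, Real.norm_eq_abs, sq_abs,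
      ← Real.rpow_mul_natCast (hf i).le, Real.div_rpow (hg' j) (hf i).le]
    have : r / 2 * (2 : ℕ) = r := by push_cast; ring
    rw [this]
    have := (Real.rpow_pos_of_pos (hf i) r).ne'
    field_simp

theorem sum_rpow_le_of_one_lt {K : Matrix m (ρ × n) ℂ}
    (hK : ∀ X : Matrix n n ℂ, (K * ((1 : Matrix ρ ρ ℂ) ⊗ₖ X) * Kᴴ).trace = X.trace)
    {U : Matrix n n ℂ} (hU : Uᴴ * U = 1) {f : n → ℝ} (hf : ∀ i, 0 < f i)
    {V : Matrix m m ℂ} (hV : Vᴴ * V = 1) {h : m → ℝ} (hh : ∀ i, 0 < h i)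
    (hout : spectralPow V h 1 = K * ((1 : Matrix ρ ρ ℂ) ⊗ₖ spectralPow U f 1) * Kᴴ)
    {α s : ℝ} (hα : 1 < α) (hs : s = (1 - α) / (2 * α)) (Y : Matrix n n ℂ)
    {Q : Matrix n n ℂ} (hQ : Qᴴ * Q = 1) {e : n → ℝ} (he : ∀ i, 0 ≤ e i)
    (hQe : (spectralPow U f s * Y)ᴴ * (spectralPow U f s * Y) =
      Q * diagonal (fun i => (e i : ℂ)) * Qᴴ)
    {R : Matrix (ρ × n) (ρ × n) ℂ} (hR : Rᴴ * R = 1) {q : ρ × n → ℝ} (hq : ∀ i, 0 ≤ q i)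
    (hRq : (spectralPow V h s * (K * ((1 : Matrix ρ ρ ℂ) ⊗ₖ Y)))ᴴ *
      (spectralPow V h s * (K * ((1 : Matrix ρ ρ ℂ) ⊗ₖ Y))) =
      R * diagonal (fun i => (q i : ℂ)) * Rᴴ)
    (hepos : 0 < ∑ i, e i ^ α) (hqpos : 0 < ∑ i, q i ^ α) :
    ∑ i, q i ^ α ≤ ∑ i, e i ^ α := by
  have hα0 : 0 < α := by linarith
  set r := (α - 1) / α with hr
  have hr0 : 0 < r := div_pos (by linarith) hα0
  have hr1' : α * (1 - r) = 1 := by rw [hr]; field_simp; ring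
  have hr1 : r ≤ 1 := by rw [hr, div_le_one hα0]; linarith
  have hs1 : -(r / 2) = s := by rw [hr, hs]; field_simp; ring
  have hs2 : r / 2 + s = 0 := by linarith
  have key := sum_rpow_mul_norm_sq_channel_le hK hU hf hV hh hout hR
    (g := fun k => q k ^ α) (fun k => Real.rpow_nonneg (hq k) α) hQ (c := fun i => e i ^ α) (d := e)
    (fun k => Real.rpow_nonneg (he k) α) hr0 hr1
    (fun i => by rw [← Real.rpow_mul (he i), hr1', Real.rpow_one]) hepos hqpos hQe
  rw [← Matrix.mul_assoc (spectralPow U f _), spectralPow_mul hU hf, hs2, spectralPow_zero hU,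
    Matrix.one_mul, hs1] at key
  have hlhs : ∀ k, (q k ^ α) ^ r * q k = q k ^ α := fun k => by
    rw [← Real.rpow_mul (hq k)]
    nth_rewrite 2 [← Real.rpow_one (q k)]
    rw [← Real.rpow_add_of_nonneg (hq k) (by positivity) zero_le_one]
    congr 1
    linarith
  simp only [sum_norm_sq_mul_eigenbasis hR hRq, hlhs] at key
  set A := ∑ i, e i ^ α
  set B := ∑ i, q i ^ α
  have h1 : B ^ (1 - r) ≤ A ^ (1 - r) := by
    rw [Real.rpow_sub hqpos, Real.rpow_one, div_le_iff₀ (Real.rpow_pos_of_pos hqpos r)]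
    exact key
  refine (Real.rpow_le_rpow_iff hqpos.le hepos.le ?_).mp h1
  by_contra hcon
  nlinarith

omit [DecidableEq ι] [DecidableEq κ] in
theorem norm_trace_conjTranspose_mul_le (L H : Matrix ι κ ℂ) :
    ‖(Lᴴ * H).trace‖ ≤ ∑ k, √(∑ i, ‖L i k‖ ^ 2) * √(∑ i, ‖H i k‖ ^ 2) := by
  refine (norm_sum_le _ _).trans (Finset.sum_le_sum fun k _ => ?_)
  rw [diag_apply, mul_apply]
  refine (norm_sum_le _ _).trans (le_trans (le_of_eq ?_) (Real.sum_mul_le_sqrt_mul_sqrt _ _ _))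
  simp

theorem sum_rpow_le_of_lt_one {K : Matrix m (ρ × n) ℂ}
    (hK : ∀ X : Matrix n n ℂ, (K * ((1 : Matrix ρ ρ ℂ) ⊗ₖ X) * Kᴴ).trace = X.trace)
    {U : Matrix n n ℂ} (hU : Uᴴ * U = 1) {f : n → ℝ} (hf : ∀ i, 0 < f i)
    {V : Matrix m m ℂ} (hV : Vᴴ * V = 1) {h : m → ℝ} (hh : ∀ i, 0 < h i)
    (hout : spectralPow V h 1 = K * ((1 : Matrix ρ ρ ℂ) ⊗ₖ spectralPow U f 1) * Kᴴ)
    {α s : ℝ} (hα2 : 1 / 2 ≤ α) (hα : α < 1) (hs : s = (1 - α) / (2 * α)) (Y : Matrix n n ℂ)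
    {Q : Matrix n n ℂ} (hQ : Qᴴ * Q = 1) {e : n → ℝ} (he : ∀ i, 0 ≤ e i)
    (hQe : (spectralPow U f s * Y)ᴴ * (spectralPow U f s * Y) =
      Q * diagonal (fun i => (e i : ℂ)) * Qᴴ)
    {R : Matrix (ρ × n) (ρ × n) ℂ} (hR : Rᴴ * R = 1) {q : ρ × n → ℝ} (hq : ∀ i, 0 ≤ q i)
    (hRq : (spectralPow V h s * (K * ((1 : Matrix ρ ρ ℂ) ⊗ₖ Y)))ᴴ *
      (spectralPow V h s * (K * ((1 : Matrix ρ ρ ℂ) ⊗ₖ Y))) =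
      R * diagonal (fun i => (q i : ℂ)) * Rᴴ)
    (hepos : 0 < ∑ i, e i ^ α) (hqpos : 0 < ∑ i, q i ^ α) :
    ∑ i, e i ^ α ≤ ∑ i, q i ^ α := by
  have hα0 : 0 < α := by linarith
  set r := (1 - α) / α with hr
  have hr0 : 0 < r := div_pos (by linarith) hα0
  have hr1 : r ≤ 1 := by rw [hr, div_le_one hα0]; linarith
  have hr2 : α * r + α = 1 := by rw [hr]; field_simp; ring
  have hs1 : r / 2 = s := by rw [hr, hs]; field_simp
  set G := spectralPow U f s * Y with hG
  set Z := G * spectralPow Q e (α - 1) with hZdef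
  set d : n → ℝ := fun i => e i ^ (α - 1) * (e i * e i ^ (α - 1)) with hd
  have hQQ := mul_eq_one_comm.mp hQ
  have hZG : Zᴴ * G = Q * diagonal (fun i => ((e i ^ (α - 1) * e i : ℝ) : ℂ)) * Qᴴ := by
    rw [hZdef, conjTranspose_mul, conjTranspose_spectralPow, Matrix.mul_assoc, hQe, spectralPow]
    simp only [Complex.ofReal_mul, ← diagonal_mul_diagonal, Matrix.mul_assoc]
    rw [← Matrix.mul_assoc Qᴴ Q, hQ, Matrix.one_mul]
  have hZ : Zᴴ * Z = Q * diagonal (fun k => (d k : ℂ)) * Qᴴ := by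
    nth_rewrite 2 [hZdef]
    rw [← Matrix.mul_assoc, hZG, spectralPow]
    have : (fun k => (d k : ℂ)) = fun k =>
        ((e k ^ (α - 1) * e k : ℝ) : ℂ) * ((e k ^ (α - 1) : ℝ) : ℂ) := by
      ext k; rw [hd, ← Complex.ofReal_mul, mul_assoc]
    rw [this, ← diagonal_mul_diagonal]
    simp only [Matrix.mul_assoc]
    rw [← Matrix.mul_assoc Qᴴ Q, hQ, Matrix.one_mul]
  have hpow : ∀ i, e i ^ (α - 1) * e i = e i ^ α := fun i => by
    rcases (he i).eq_or_lt with h0 | h0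
    · rw [← h0, mul_zero, Real.zero_rpow hα0.ne']
    · rw [Real.rpow_sub_one h0.ne', div_mul_cancel₀ _ h0.ne']
  have hdle : ∀ i, d i ≤ (e i ^ α) ^ (1 - r) := fun i => by
    rcases (he i).eq_or_lt with h0 | h0
    · simp only [hd, ← h0, zero_mul, mul_zero]
      positivity
    · simp only [hd]
      rw [← mul_assoc, hpow, ← Real.rpow_add h0, ← Real.rpow_mul h0.le]
      refine le_of_eq ?_
      congr 1
      linarith
  have key := sum_rpow_mul_norm_sq_channel_le hK hU hf hV hh hout hR
    (g := fun k => q k ^ α) (fun k => Real.rpow_nonneg (hq k) α) hQ (c := fun i => e i ^ α)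
    (fun k => Real.rpow_nonneg (he k) α) hr0 hr1 hdle hepos hqpos hZ
  rw [hs1] at key
  set L := spectralPow V h (-s) * (K * ((1 : Matrix ρ ρ ℂ) ⊗ₖ (spectralPow U f s * Z))) with hL
  set H := spectralPow V h s * (K * ((1 : Matrix ρ ρ ℂ) ⊗ₖ Y)) with hH
  set A := ∑ i, e i ^ α with hA
  set B := ∑ i, q i ^ α with hB
  have htr : ((L * R)ᴴ * (H * R)).trace = (A : ℂ) := by
    calc ((L * R)ᴴ * (H * R)).trace = (Lᴴ * H).trace := by
          rw [conjTranspose_mul, Matrix.mul_assoc, trace_mul_comm, Matrix.mul_assoc,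
            Matrix.mul_assoc, mul_eq_one_comm.mp hR, Matrix.mul_one]
      _ = ((K * ((1 : Matrix ρ ρ ℂ) ⊗ₖ (spectralPow U f s * Z)))ᴴ *
            (K * ((1 : Matrix ρ ρ ℂ) ⊗ₖ Y))).trace := by
          rw [hL, hH, conjTranspose_mul, conjTranspose_spectralPow, Matrix.mul_assoc,
            ← Matrix.mul_assoc (spectralPow V h (-s)), spectralPow_mul hV hh, neg_add_cancel,
            spectralPow_zero hV, Matrix.one_mul]
      _ = (K * ((1 : Matrix ρ ρ ℂ) ⊗ₖ (Y * (spectralPow U f s * Z)ᴴ)) * Kᴴ).trace := by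
          rw [trace_mul_comm, conjTranspose_mul, conjTranspose_kronecker, conjTranspose_one,
            Matrix.mul_assoc K, ← Matrix.mul_assoc (_ ⊗ₖ _), ← mul_kronecker_mul, Matrix.one_mul,
            ← Matrix.mul_assoc]
      _ = (Zᴴ * G).trace := by
          rw [hK, conjTranspose_mul, conjTranspose_spectralPow, trace_mul_comm, Matrix.mul_assoc]
      _ = A := by
          rw [hZG, trace_mul_comm, ← Matrix.mul_assoc, hQ, Matrix.one_mul, trace_diagonal, hA]
          simp only [hpow, Complex.ofReal_sum]
  have hnorm := norm_trace_conjTranspose_mul_le (L * R) (H * R)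
  rw [htr, Complex.norm_real, Real.norm_eq_abs, abs_of_pos hepos] at hnorm
  have hterm : ∀ k, √(∑ i, ‖(L * R) i k‖ ^ 2) * √(∑ i, ‖(H * R) i k‖ ^ 2) =
      √((q k ^ α) ^ r * ∑ i, ‖(L * R) i k‖ ^ 2) * √(q k ^ α) := fun k => by
    have hqk : q k = (q k ^ α) ^ r * q k ^ α := by
      rw [← Real.rpow_mul (hq k), ← Real.rpow_add_of_nonneg (hq k) (by positivity) hα0.le, hr2,
        Real.rpow_one]
    have h0 : 0 ≤ ∑ i, ‖(L * R) i k‖ ^ 2 := by positivity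
    have h1 := Real.rpow_nonneg (Real.rpow_nonneg (hq k) α) r
    rw [sum_norm_sq_mul_eigenbasis hR hRq, ← Real.sqrt_mul h0, ← Real.sqrt_mul (mul_nonneg h1 h0)]
    nth_rewrite 1 [hqk]
    congr 1
    ring
  simp only [hterm] at hnorm
  have hcs := hnorm.trans (Real.sum_sqrt_mul_sqrt_le Finset.univ
    (fun k => mul_nonneg (Real.rpow_nonneg (Real.rpow_nonneg (hq k) α) r)
      (Finset.sum_nonneg fun i _ => sq_nonneg _)) (fun k => Real.rpow_nonneg (hq k) α))
  have hsq : A ^ 2 ≤ A ^ (1 - r) * B ^ r * B := by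
    have hX : 0 ≤ ∑ k, (q k ^ α) ^ r * ∑ i, ‖(L * R) i k‖ ^ 2 :=
      Finset.sum_nonneg fun k _ => mul_nonneg (Real.rpow_nonneg (Real.rpow_nonneg (hq k) α) r)
        (Finset.sum_nonneg fun i _ => sq_nonneg _)
    calc A ^ 2 ≤ (√(∑ k, (q k ^ α) ^ r * ∑ i, ‖(L * R) i k‖ ^ 2) * √B) ^ 2 := by gcongr
      _ = (∑ k, (q k ^ α) ^ r * ∑ i, ‖(L * R) i k‖ ^ 2) * B := by
          rw [mul_pow, Real.sq_sqrt hX, Real.sq_sqrt hqpos.le]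
      _ ≤ _ := by gcongr
  have hfin : A ^ (1 + r) ≤ B ^ (1 + r) := by
    have e1 : A ^ 2 = A ^ (1 - r) * A ^ (1 + r) := by
      rw [← Real.rpow_add hepos, ← Real.rpow_natCast]; congr 1; push_cast; ring
    have e2 : B ^ r * B = B ^ (1 + r) := by
      rw [Real.rpow_add hqpos, Real.rpow_one, mul_comm]
    rw [e1, mul_assoc, e2] at hsq
    exact le_of_mul_le_mul_left hsq (Real.rpow_pos_of_pos hepos _)
  exact (Real.rpow_le_rpow_iff hepos.le hqpos.le (by linarith)).mp hfin

omit [DecidableEq ι] in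
theorem sum_rpow_eigenvalues_pos {G : Matrix ι κ ℂ} (hG : G ≠ 0) {Q : Matrix κ κ ℂ} {e : κ → ℝ}
    (he : ∀ k, 0 ≤ e k) (hQ : Gᴴ * G = Q * diagonal (fun k => (e k : ℂ)) * Qᴴ) (α : ℝ) :
    0 < ∑ k, e k ^ α := by
  refine Finset.sum_pos' (fun k _ => Real.rpow_nonneg (he k) α) ?_
  by_contra! h
  have h0 : ∀ k, e k = 0 := fun k => by
    by_contra hk
    exact (h k (Finset.mem_univ k)).not_gt
      (Real.rpow_pos_of_pos (lt_of_le_of_ne (he k) (Ne.symm hk)) α)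
  apply hG
  rw [← conjTranspose_mul_self_eq_zero, hQ]
  simp [h0]

omit [Fintype κ] [DecidableEq κ] in
theorem spectralPow_mul_ne_zero {U : Matrix ι ι ℂ} (hU : Uᴴ * U = 1) {f : ι → ℝ}
    (hf : ∀ i, 0 < f i) (s : ℝ) {X : Matrix ι κ ℂ} (hX : X ≠ 0) : spectralPow U f s * X ≠ 0 := by
  intro h
  apply hX
  rw [← Matrix.one_mul X, ← spectralPow_zero hU f, ← neg_add_cancel s, ← spectralPow_mul hU hf,
    Matrix.mul_assoc, h, Matrix.mul_zero]

end MatrixEstimates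

theorem Matrix.PosDef.exists_mpow_eq_spectralPow {n : ℕ} {φ : Matrix (Fin n) (Fin n) ℂ}
    (hφ : φ.PosDef) : ∃ (U : Matrix (Fin n) (Fin n) ℂ) (f : Fin n → ℝ), Uᴴ * U = 1 ∧
      (∀ i, 0 < f i) ∧ (∀ s, mpow φ s = spectralPow U f s) ∧ φ = spectralPow U f 1 := by
  refine ⟨hφ.1.eigenvectorUnitary, hφ.1.eigenvalues, Unitary.coe_star_mul_self _,
    hφ.eigenvalues_pos, fun s => by rw [mpow, dif_pos hφ.1]; rfl, ?_⟩
  have h := hφ.1.spectral_theorem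
  rw [Unitary.conjStarAlgAut_apply] at h
  simp only [spectralPow, Real.rpow_one]
  exact h

theorem trace_mpow {n : ℕ} {A : Matrix (Fin n) (Fin n) ℂ} (hA : A.IsHermitian) (r : ℝ) :
    (mpow A r).trace = ((∑ i, hA.eigenvalues i ^ r : ℝ) : ℂ) := by
  rw [mpow, dif_pos hA, Matrix.mul_assoc, trace_mul_comm, Matrix.mul_assoc,
    Unitary.coe_star_mul_self, Matrix.mul_one, trace_diagonal, Complex.ofReal_sum]

open Polynomial in
theorem re_trace_mpow_mul_conjTranspose {n : ℕ} {κ : Type*} [Fintype κ] [DecidableEq κ]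
    (G : Matrix (Fin n) κ ℂ) {R : Matrix κ κ ℂ} (hR : Rᴴ * R = 1) {q : κ → ℝ}
    (hq : Gᴴ * G = R * diagonal (fun k => (q k : ℂ)) * Rᴴ) {α : ℝ} (hα : 0 < α) :
    (mpow (G * Gᴴ) α).trace.re = ∑ k, q k ^ α := by
  have hH : (G * Gᴴ).IsHermitian := isHermitian_mul_conjTranspose_self G
  have hchar : (Gᴴ * G).charpoly = ∏ k, (X - C (q k : ℂ)) := by
    rw [hq, Matrix.charpoly_mul_comm, ← Matrix.mul_assoc, hR, Matrix.one_mul, charpoly_diagonal]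
  have hroots := congrArg Polynomial.roots (Matrix.charpoly_mul_comm' G Gᴴ)
  have hX (k : ℕ) : (X ^ k : ℂ[X]) ≠ 0 := pow_ne_zero k X_ne_zero
  rw [roots_mul (mul_ne_zero (hX _) (Matrix.charpoly_monic _).ne_zero),
    roots_mul (mul_ne_zero (hX _) (Matrix.charpoly_monic _).ne_zero), hchar,
    roots_pow, roots_pow, roots_X, hH.roots_charpoly_eq_eigenvalues,
    roots_prod _ _ (Finset.prod_ne_zero_iff.mpr fun k _ => X_sub_C_ne_zero _)] at hroots
  have hsum := congrArg (fun s => (s.map fun z : ℂ => z.re ^ α).sum) hroots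
  simp only [Multiset.map_add, Multiset.sum_add, Multiset.map_nsmul, Multiset.sum_nsmul,
    Multiset.map_singleton, Multiset.sum_singleton, Complex.zero_re, Real.zero_rpow hα.ne',
    smul_zero, zero_add, Multiset.map_map, roots_X_sub_C, Multiset.bind_singleton] at hsum
  rw [trace_mpow hH, Complex.ofReal_re]
  exact hsum

theorem IsCompletelyPositive.exists_kraus {n m : ℕ}
    {Φ : Matrix (Fin n) (Fin n) ℂ →ₗ[ℂ] Matrix (Fin m) (Fin m) ℂ}
    (hΦ : IsCompletelyPositive Φ) (hn : 1 ≤ n) :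
    ∃ K : Matrix (Fin m) ((Fin m × Fin n) × Fin n) ℂ,
      ∀ X, Φ X = K * ((1 : Matrix (Fin m × Fin n) (Fin m × Fin n) ℂ) ⊗ₖ X) * Kᴴ := by
  let δ : Fin n × Fin n → ℂ := fun p => if p.1 = p.2 then 1 else 0
  obtain ⟨B, hB⟩ := (hΦ n hn _ (posSemidef_vecMulVec_self_star δ)).exists_eq_conjTranspose_mul_self
  have hsingle (i j : Fin n) (a b : Fin m) :
      Φ (single i j 1) a b = ∑ x, star (B x (a, i)) * B x (b, j) := by
    have h := congrFun (congrFun hB (a, i)) (b, j)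
    simp only [mul_apply, conjTranspose_apply, blockApply, of_apply] at h
    rw [← h]
    refine congrFun (congrFun (congrArg Φ ?_) a) b
    ext k l
    by_cases h1 : i = k <;> by_cases h2 : j = l <;>
      simp [δ, vecMulVec_apply, h1, h2, eq_comm]
  refine ⟨of fun a p => star (B p.1 (a, p.2)), fun X => ?_⟩
  ext a b
  have hX : Φ X = ∑ i, ∑ j, X i j • Φ (single i j 1) := by
    conv_lhs => rw [matrix_eq_sum_single X]
    simp only [map_sum]
    refine Finset.sum_congr rfl fun i _ => Finset.sum_congr rfl fun j _ => ?_
    rw [← map_smul, smul_single, smul_eq_mul, mul_one]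
  simp only [hX, Matrix.sum_apply, Matrix.smul_apply, hsingle, mul_apply, kroneckerMap_apply,
    one_apply, of_apply, conjTranspose_apply, star_star, smul_eq_mul,
    Fintype.sum_prod_type (α₁ := Fin m × Fin n), ite_mul, mul_ite, one_mul, zero_mul, mul_zero]
  have hcol (x : Fin m × Fin n) (j : Fin n) :
      (∑ y, ∑ i, if y = x then star (B y (a, i)) * X i j else 0) =
        ∑ i, star (B x (a, i)) * X i j := by
    rw [Finset.sum_comm]
    simp
  simp only [hcol, Finset.mul_sum, Finset.sum_mul]
  calc ∑ i, ∑ j, ∑ x, X i j * (star (B x (a, i)) * B x (b, j))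
      = ∑ i, ∑ x, ∑ j, X i j * (star (B x (a, i)) * B x (b, j)) :=
        Finset.sum_congr rfl fun _ _ => Finset.sum_comm
    _ = ∑ x, ∑ i, ∑ j, X i j * (star (B x (a, i)) * B x (b, j)) := Finset.sum_comm
    _ = ∑ x, ∑ j, ∑ i, X i j * (star (B x (a, i)) * B x (b, j)) :=
        Finset.sum_congr rfl fun _ _ => Finset.sum_comm
    _ = ∑ x, ∑ j, ∑ i, star (B x (a, i)) * X i j * B x (b, j) :=
        Finset.sum_congr rfl fun _ _ => Finset.sum_congr rfl fun _ _ =>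
          Finset.sum_congr rfl fun _ _ => by ring

theorem data_processing_inequality {n m : ℕ}
    (Φ : Matrix (Fin n) (Fin n) ℂ →ₗ[ℂ] Matrix (Fin m) (Fin m) ℂ)
    (hΦ : IsQuantumChannel Φ)
    (ψ φ : Matrix (Fin n) (Fin n) ℂ)
    (hψ : ψ.PosSemidef) (hψ1 : ψ.trace = 1) (hφ : φ.PosDef) (hΦφ : (Φ φ).PosDef)
    (α : ℝ) (hα : (1 / 2 ≤ α ∧ α < 1) ∨ 1 < α) :
    sandwichedRenyi α (Φ ψ) (Φ φ) ≤ sandwichedRenyi α ψ φ := by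

  obtain ⟨hcp, htp⟩ := hΦ
  have hα0 : 0 < α := by rcases hα with h | h <;> linarith
  have hn : 1 ≤ n := by
    rcases Nat.eq_zero_or_pos n with rfl | h
    · simp [trace] at hψ1
    · exact h
  obtain ⟨K, hΦK⟩ := hcp.exists_kraus hn
  have hK (X : Matrix (Fin n) (Fin n) ℂ) :
      (K * ((1 : Matrix (Fin m × Fin n) (Fin m × Fin n) ℂ) ⊗ₖ X) * Kᴴ).trace =
        X.trace := by
    rw [← hΦK, htp]
  obtain ⟨U, f, hU, hf, hφpow, hφ1⟩ := hφ.exists_mpow_eq_spectralPow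
  obtain ⟨V, h, hV, hh, hΦφpow, hΦφ1⟩ := hΦφ.exists_mpow_eq_spectralPow
  have hout : spectralPow V h 1 =
      K * ((1 : Matrix (Fin m × Fin n) (Fin m × Fin n) ℂ) ⊗ₖ spectralPow U f 1) * Kᴴ := by
    rw [← hΦφ1, ← hφ1, hΦK]
  obtain ⟨B, hB⟩ := hψ.exists_eq_conjTranspose_mul_self
  obtain ⟨Y, hY⟩ : ∃ Y : Matrix (Fin n) (Fin n) ℂ, Y * Yᴴ = ψ :=
    ⟨Bᴴ, by rw [conjTranspose_conjTranspose, hB]⟩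
  have hW : K * ((1 : Matrix (Fin m × Fin n) (Fin m × Fin n) ℂ) ⊗ₖ Y) *
      (K * ((1 : Matrix (Fin m × Fin n) (Fin m × Fin n) ℂ) ⊗ₖ Y))ᴴ = Φ ψ := by
    rw [hΦK, ← hY, conjTranspose_mul, conjTranspose_kronecker, conjTranspose_one, Matrix.mul_assoc,
      ← Matrix.mul_assoc (_ ⊗ₖ _), ← mul_kronecker_mul, Matrix.one_mul, ← Matrix.mul_assoc]
  have hY0 : Y ≠ 0 := by
    rintro rfl
    simp [← hY] at hψ1
  have hW0 : K * ((1 : Matrix (Fin m × Fin n) (Fin m × Fin n) ℂ) ⊗ₖ Y) ≠ 0 := fun h0 => by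
    have h1 := (htp ψ).trans hψ1
    rw [← hW, h0] at h1
    simp at h1
  set s := (1 - α) / (2 * α) with hs
  obtain ⟨Q, e, hQ, he, hQe⟩ :=
    (posSemidef_conjTranspose_mul_self (spectralPow U f s * Y)).exists_spectral
  obtain ⟨R, q, hR, hq, hRq⟩ := (posSemidef_conjTranspose_mul_self
    (spectralPow V h s * (K * ((1 : Matrix (Fin m × Fin n) (Fin m × Fin n) ℂ) ⊗ₖ
      Y)))).exists_spectral
  have hepos := sum_rpow_eigenvalues_pos (spectralPow_mul_ne_zero hU hf s hY0) he hQe α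
  have hqpos := sum_rpow_eigenvalues_pos (spectralPow_mul_ne_zero hV hh s hW0) hq hRq α
  have hin : (mpow (mpow φ s * ψ * mpow φ s) α).trace.re = ∑ k, e k ^ α := by
    rw [← re_trace_mpow_mul_conjTranspose _ hQ hQe hα0, hφpow, ← hY, conjTranspose_mul,
      conjTranspose_spectralPow]
    simp only [Matrix.mul_assoc]
  have hfin : (mpow (mpow (Φ φ) s * Φ ψ * mpow (Φ φ) s) α).trace.re = ∑ k, q k ^ α := by
    rw [← re_trace_mpow_mul_conjTranspose _ hR hRq hα0, hΦφpow, ← hW,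
      conjTranspose_mul (spectralPow V h s), conjTranspose_spectralPow]
    simp only [Matrix.mul_assoc]
  rw [sandwichedRenyi, sandwichedRenyi, ← hs, hin, hfin]
  rcases hα with ⟨hα2, hα1⟩ | hα1
  · refine mul_le_mul_of_nonpos_left (Real.log_le_log hepos ?_)
      (one_div_nonpos.mpr (by linarith))
    exact sum_rpow_le_of_lt_one hK hU hf hV hh hout hα2 hα1 hs Y hQ he hQe hR hq hRq hepos hqpos
  · refine mul_le_mul_of_nonneg_left (Real.log_le_log hqpos ?_)
      (one_div_nonneg.mpr (by linarith))
    exact sum_rpow_le_of_one_lt hK hU hf hV hh hout hα1 hs Y hQ he hQe hR hq hRq hepos hqpos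
end
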